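/- Let K be a field of characteristic zero and let d ≥ 3 be an integer; consider the multidegree d̲ = (1,2,…,2d−2). Then the constants of the Morin–Predonzan–Ciliberto theorem for d̲ can be chosen with q(d̲) ≥ 2d−2: there exist integers c and q with q ≥ 2d−2 such that for every r ≥ c the following holds. Let Z_0,…,Z_q,Y_{q+1},…,Y_r be variables and for j = 1,…,2d−2 let G_j = Σ_{|I| < j} b_{j,I,J} Z^I Y^J be homogeneous of degree j with every monomial involving at least one Y-variable, all coefficients b_{j,I,J} algebraically independent over K; let K_1 be the field generated over K by the coefficients, set g_j = G_j(1,z_1,…,z_q,y_{q+1},…,y_r), and assume the ideal (g_1,…,g_{2d−2}) of K_1[z,y] is prime. Then the fraction field of K_1[z,y]/(g_1,…,g_{2d−2}) admits a K_1-algebra embedding into a rational function field K_1(t_1,…,t_N) for some N. -/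

import Mathlib

universe u

/-- The conclusion of the Morin–Predonzan theorem in Ciliberto's version, for a base
field `K`, a multidegree `dv : Fin m → ℕ`, and candidate constants `c` and `q`:
for every `r ≥ c` (with `q < r`), whenever `G 1, …, G m` are homogeneous forms of degrees
`dv 1, …, dv m` in the variables `Z_0, …, Z_q, Y_{q+1}, …, Y_r` (the variable of index
`i` is a `Z`-variable if `i ≤ q` and a `Y`-variable if `i > q`), each of whose monomials
involves at least one `Y`-variable (so that the linear space `L₀ = {Y = 0}` is contained
in `V = {G 1 = … = G m = 0}`), whose coefficients (in an extension field `K1` of `K`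
generated by them) are all together algebraically independent over `K` — i.e. `V` is
generic over `K` subject to containing `L₀` —, and such that the ideal generated by the
dehomogenizations `g j = G j (1, z_1, …, z_q, y_{q+1}, …, y_r)` is prime, the fraction
field of `K1[z,y]/(g_1, …, g_m)` (the function field of `V` over `K1`) admits a
`K1`-algebra embedding into a rational function field `K1(t_1, …, t_N)`; that is, `V` is
unirational over `K1 = K(l(L₀), θ(V))`. -/
def MPCProperty (K : Type u) [Field K] (m : ℕ) (dv : Fin m → ℕ) (c q : ℕ) : Prop :=
  ∀ r : ℕ, c ≤ r → q < r →
    ∀ (K1 : Type u) [Field K1] [Algebra K K1]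
      (G : Fin m → MvPolynomial (Fin (r + 1)) K1),
      (∀ j, (G j).IsHomogeneous (dv j)) →
      (∀ j, ∀ μ ∈ (G j).support, ∃ i : Fin (r + 1), q < (i : ℕ) ∧ μ i ≠ 0) →
      AlgebraicIndependent K (fun p : (Σ j : Fin m, {μ : Fin (r + 1) →₀ ℕ //
          (∑ i, μ i) = dv j ∧ ∃ i : Fin (r + 1), q < (i : ℕ) ∧ μ i ≠ 0}) =>
        (G p.1).coeff p.2.1) →
      IntermediateField.adjoin K (⋃ j, Set.range (G j).coeff) = ⊤ →
      (Ideal.span (Set.range fun j => MvPolynomial.aeval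
          (fun i : Fin (r + 1) =>
            Fin.cases (motive := fun _ => MvPolynomial (Fin r) K1) 1
              (fun i' => MvPolynomial.X i') i) (G j))).IsPrime →
      ∃ (N : ℕ) (ψ : FractionRing ((MvPolynomial (Fin r) K1) ⧸
          (Ideal.span (Set.range fun j => MvPolynomial.aeval
            (fun i : Fin (r + 1) =>
              Fin.cases (motive := fun _ => MvPolynomial (Fin r) K1) 1
                (fun i' => MvPolynomial.X i') i) (G j)))) →ₐ[K1]
            FractionRing (MvPolynomial (Fin N) K1)),
        Function.Injective ψ

section helpers

open MvPolynomial

lemma mpc_height_aux {k : Type*} [Field k] (n t : ℕ) (ht : t ≤ n) :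
    (t : ℕ∞) ≤ (RingHom.ker (aeval (R := k) (fun i : Fin n => if (i : ℕ) < t then (0 : MvPolynomial (Fin n) k) else X i))).height := by
  induction t with
  | zero => simp
  | succ t ih =>
    have h1 := ih (by omega)
    have i1 := RingHom.ker_isPrime (aeval (R := k) (fun i : Fin n => if (i : ℕ) < t then (0 : MvPolynomial (Fin n) k) else X i)).toRingHom
    have i2 := RingHom.ker_isPrime (aeval (R := k) (fun i : Fin n => if (i : ℕ) < t + 1 then (0 : MvPolynomial (Fin n) k) else X i)).toRingHom
    refine le_trans (by push_cast; exact add_le_add_left h1 1) (@Ideal.height_add_one_le_of_lt_of_isPrime _ _ _ _ i1 i2 ?_)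
    refine lt_of_le_of_ne ?_ ?_
    · intro p hp
      rw [RingHom.mem_ker] at hp ⊢
      have : (aeval (R := k) (fun i : Fin n => if (i : ℕ) < t + 1 then (0 : MvPolynomial (Fin n) k) else X i))
        = (aeval (R := k) (fun i : Fin n => if (i : ℕ) < t + 1 then (0 : MvPolynomial (Fin n) k) else X i)).comp (aeval (R := k) (fun i : Fin n => if (i : ℕ) < t then (0 : MvPolynomial (Fin n) k) else X i)) := by
        apply MvPolynomial.algHom_ext
        intro i
        simp only [AlgHom.comp_apply, aeval_X]
        split_ifs with h1 h2 <;> simp <;> omega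
      rw [this, AlgHom.comp_apply]
      erw [hp]; simp
    · intro h
      have : (X ⟨t, by omega⟩ : MvPolynomial (Fin n) k) ∈ RingHom.ker (aeval (R := k) (fun i : Fin n => if (i : ℕ) < t then (0 : MvPolynomial (Fin n) k) else X i)) := by
        refine h.ge ?_
        rw [RingHom.mem_ker]; simp
      rw [RingHom.mem_ker] at this
      simp at this

/-- `N` polynomials without constant term in `n > N` variables over an algebraically closed
field have a common zero different from the origin. -/
lemma mpc_exists_zero {k : Type*} [Field k] [IsAlgClosed k] {κ : Type*} [Fintype κ] (n : ℕ)
    (hn : Fintype.card κ < n) (f : κ → MvPolynomial (Fin n) k) (h0 : ∀ i, eval 0 (f i) = 0) :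
    ∃ x : Fin n → k, x ≠ 0 ∧ ∀ i, eval x (f i) = 0 := by
  classical
  by_contra! hcon
  set J := Ideal.span (Set.range f) with hJ
  have hz : zeroLocus k J = {0} := by
    rw [hJ, zeroLocus_span]
    ext x
    simp only [Set.mem_ofPred_eq, Set.mem_range, forall_exists_index, forall_apply_eq_imp_iff, Set.mem_singleton_iff]
    constructor
    · intro h
      by_contra hx
      obtain ⟨i, hi⟩ := hcon x hx
      exact hi (by simpa using h i)
    · rintro rfl i
      simpa using h0 i
  have hr := vanishingIdeal_zeroLocus_eq_radical (K := k) J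
  rw [hz] at hr
  have hk : RingHom.ker (aeval (R := k) (fun i : Fin n => if (i : ℕ) < n then (0 : MvPolynomial (Fin n) k) else X i)) = vanishingIdeal k ({0} : Set (Fin n → k)) := by
    ext p
    rw [mem_vanishingIdeal_singleton_iff, RingHom.mem_ker]
    have : (fun i : Fin n => if (i : ℕ) < n then (0 : MvPolynomial (Fin n) k) else X i) = fun i => C ((0 : Fin n → k) i) := by
      ext1 i; simp
    rw [this]
    have h2 : aeval (fun i => C ((0 : Fin n → k) i)) p = (C (aeval (0 : Fin n → k) p) : MvPolynomial (Fin n) k) := by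
      have := MvPolynomial.aeval_algebraMap_apply (A := k) (B := MvPolynomial (Fin n) k) (0 : Fin n → k) p
      exact this
    rw [h2]; simp
  have h3 := mpc_height_aux (k := k) n n le_rfl
  have h4 : J.height ≤ (Fintype.card κ : ℕ∞) := by
    refine (Ideal.height_le_spanFinrank J ?_).trans ?_
    · intro hJt
      have : (zeroLocus k J) = ∅ := by rw [hJt]; ext x; simp [zeroLocus]; exact ⟨1, by simp⟩
      rw [hz] at this; simp at this
    · have := Submodule.spanFinrank_span_le_ncard_of_finite (R := MvPolynomial (Fin n) k) (Set.finite_range f)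
      have h6 : (Set.range f).ncard ≤ Fintype.card κ := by
        rw [← Set.image_univ, ← Nat.card_eq_fintype_card, ← Set.ncard_univ]
        exact Set.ncard_image_le
      exact_mod_cast this.trans h6
  have h5 : J.radical.height = J.height := by
    rw [Ideal.height_eq_inf_minimalPrimes, Ideal.height_eq_inf_minimalPrimes J, Ideal.radical_minimalPrimes]
  rw [hk, hr, h5] at h3
  have := h3.trans h4
  have : n ≤ Fintype.card κ := by exact_mod_cast this
  omega

lemma mpc_totalDegree_aeval {R A ι σ : Type*} [CommRing R] [CommRing A] [Algebra R A]
    (f : ι → MvPolynomial σ A) (hf : ∀ i, (f i).totalDegree ≤ 1) (G : MvPolynomial ι R) :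
    (aeval f G).totalDegree ≤ G.totalDegree := by
  rw [aeval_def, eval₂_eq]
  refine totalDegree_finsetSum_le ?_
  intro μ hμ
  refine (totalDegree_mul _ _).trans ?_
  have h1 : (algebraMap R (MvPolynomial σ A) (coeff μ G)).totalDegree = 0 := by
    rw [MvPolynomial.algebraMap_apply]; exact totalDegree_C _
  rw [h1, zero_add]
  refine (totalDegree_finsetProd _ _).trans ?_
  refine le_trans ?_ (le_totalDegree hμ)
  rw [Finsupp.sum]
  refine Finset.sum_le_sum fun i _ => ?_
  refine (totalDegree_pow _ _).trans ?_
  calc _ ≤ μ i * 1 := Nat.mul_le_mul_left _ (hf i)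
    _ = _ := mul_one _

/-- Evaluation of a homogeneous polynomial at a rescaled point. -/
lemma mpc_eval_smul {R ι : Type*} [CommRing R] {d : ℕ} {G : MvPolynomial ι R}
    (hG : G.IsHomogeneous d) (c : R) (x : ι → R) :
    eval (fun i => c * x i) G = c ^ d * eval x G := by
  rw [eval_eq, eval_eq, Finset.mul_sum]
  refine Finset.sum_congr rfl fun μ hμ => ?_
  have h1 : ∑ i ∈ μ.support, μ i = d := by
    have := hG (mem_support_iff.mp hμ)
    rw [← this, Finsupp.weight_apply, Finsupp.sum]
    simp
  simp only [mul_pow, Finset.prod_mul_distrib, Finset.prod_pow_eq_pow_sum, h1]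
  ring

lemma mpc_extend {k : Type*} [Field k] [IsAlgClosed k] {ι : Type*} [Fintype ι] {m : ℕ}
    (G : Fin m → MvPolynomial ι k) (hG : ∀ j, (G j).IsHomogeneous ((j : ℕ) + 1))
    (P L : Submodule k (ι → k)) (p : ℕ) (hP : Module.finrank k P = p)
    (hv : ∀ x ∈ P, ∀ j, eval x (G j) = 0)
    (hL : p + m * (m + 1) ^ p < Module.finrank k L) :
    ∃ v ∈ L, v ∉ P ∧ ∀ x ∈ P ⊔ Submodule.span k {v}, ∀ j, eval x (G j) = 0 := by
  classical
  obtain ⟨C₀, hC₀⟩ := Submodule.exists_isCompl ((P ⊓ L).comap L.subtype)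
  set D := C₀.map L.subtype with hD
  have hDL : D ≤ L := Submodule.map_subtype_le _ _
  have hDP : ∀ x ∈ D, x ∈ P → x = 0 := by
    rintro x hx hxP
    obtain ⟨y, hy, rfl⟩ := hx
    have h1 : y ∈ (P ⊓ L).comap L.subtype := ⟨hxP, y.2⟩
    have h2 := (Submodule.disjoint_def.mp hC₀.disjoint) y h1 hy
    simp [h2]
  have hfr : Module.finrank k D + p ≥ Module.finrank k L := by
    have h1 := Submodule.finrank_add_eq_of_isCompl hC₀
    have h2 : Module.finrank k D = Module.finrank k C₀ :=
      Submodule.finrank_map_subtype_eq L C₀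
    have h3 : Module.finrank k ((P ⊓ L).comap L.subtype) ≤ p := by
      rw [← hP, ← Submodule.finrank_map_subtype_eq L]
      refine Submodule.finrank_mono ?_
      rw [Submodule.map_comap_subtype]
      exact inf_le_right.trans inf_le_left
    omega
  set n := Module.finrank k D with hn
  let c := Module.finBasis k D
  let b := Module.finBasisOfFinrankEq k P hP
  let f : ι → MvPolynomial (Fin p) (MvPolynomial (Fin n) k) := fun i =>
    ∑ a, C (C ((b a : ι → k) i)) * X a + C (∑ a, C ((c a : ι → k) i) * X a)
  have hf : ∀ i, (f i).totalDegree ≤ 1 := by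
    intro i
    refine (totalDegree_add _ _).trans (max_le ?_ (by rw [totalDegree_C]; omega))
    refine totalDegree_finsetSum_le fun a _ => ?_
    refine (totalDegree_mul _ _).trans ?_
    rw [totalDegree_C, totalDegree_X]
  have hev : ∀ (x : Fin n → k) (a : Fin p → k) j,
      eval a (map (eval x) (aeval f (G j))) =
        eval (fun i => (∑ t, a t • (b t : ι → k)) i + (∑ t, x t • (c t : ι → k)) i) (G j) := by
    intro x a j
    have : ((eval a).comp (map (eval x))).comp (aeval f).toRingHom = eval (fun i => (∑ t, a t • (b t : ι → k)) i + (∑ t, x t • (c t : ι → k)) i) := by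
      apply MvPolynomial.ringHom_ext
      · intro r
        simp [MvPolynomial.algebraMap_apply]
      · intro i
        simp [f, mul_comm]
        rfl
    exact congrArg (fun φ => φ (G j)) this
  let F : (Fin m × (Fin p → Fin (m + 1))) → MvPolynomial (Fin n) k := fun je =>
    coeff (Finsupp.equivFunOnFinite.symm fun a => (je.2 a : ℕ)) (aeval f (G je.1))
  obtain ⟨x, hx0, hx⟩ := mpc_exists_zero n (by simp; omega) F (by
    rintro ⟨j, e⟩
    have h1 : map (eval (0 : Fin n → k)) (aeval f (G j)) = 0 := by
      apply MvPolynomial.funext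
      intro a
      rw [hev]
      simp only [Pi.zero_apply, zero_smul, Finset.sum_const_zero, add_zero, map_zero]
      refine hv _ ?_ j
      exact Submodule.sum_mem _ fun t _ => P.smul_mem _ (b t).2
    have h2 := congrArg (coeff (Finsupp.equivFunOnFinite.symm fun a => (e a : ℕ))) h1
    rw [coeff_map] at h2
    simpa using h2)
  have hzero : ∀ j, map (eval x) (aeval f (G j)) = 0 := by
    intro j
    ext μ
    rw [coeff_map, coeff_zero]
    by_cases hμ : ∀ a, μ a < m + 1
    · have := hx (j, fun a => ⟨μ a, hμ a⟩)
      simp only [F] at this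
      convert this using 3
      ext a; simp
    · push Not at hμ
      obtain ⟨a, ha⟩ := hμ
      rw [coeff_eq_zero_of_totalDegree_lt, map_zero]
      refine lt_of_le_of_lt (mpc_totalDegree_aeval f hf (G j)) ?_
      refine lt_of_le_of_lt (hG j).totalDegree_le ?_
      refine lt_of_lt_of_le ?_ (Finset.single_le_sum (f := fun i => μ i) (fun _ _ => Nat.zero_le _) (Finsupp.mem_support_iff.mpr (by omega : μ a ≠ 0)))
      have := j.2
      omega
  refine ⟨∑ t, x t • (c t : ι → k), ?_, ?_, ?_⟩
  · exact Submodule.sum_mem _ fun t _ => L.smul_mem _ (hDL (c t).2)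
  · intro hvP
    have h1 := hDP _ (Submodule.sum_mem _ fun t _ => D.smul_mem _ (c t).2) hvP
    have h2 : ∑ t, x t • c t = 0 := by
      apply Subtype.ext; simpa using h1
    apply hx0
    ext t
    exact Fintype.linearIndependent_iff.mp c.linearIndependent x h2 t
  · intro y hy j
    obtain ⟨u, hu, w, hw, rfl⟩ := Submodule.mem_sup.mp hy
    obtain ⟨t, rfl⟩ := Submodule.mem_span_singleton.mp hw
    by_cases ht : t = 0
    · subst ht; simpa using hv u hu j
    · set v := ∑ t, x t • (c t : ι → k)
      have h1 : eval (fun i => (t⁻¹ • u) i + v i) (G j) = 0 := by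
        have h2 := hev x (b.repr ⟨t⁻¹ • u, P.smul_mem _ hu⟩) j
        rw [hzero] at h2
        have h3 := congrArg (fun z : P => (z : ι → k)) (b.sum_repr ⟨t⁻¹ • u, P.smul_mem _ hu⟩)
        simp only [Submodule.coe_sum, Submodule.coe_smul] at h3
        rw [h3] at h2
        rw [map_zero] at h2
        exact h2.symm
      have h4 := mpc_eval_smul (hG j) t (fun i => (t⁻¹ • u) i + v i)
      rw [h1, mul_zero] at h4
      rw [← h4]
      congr 2
      ext i
      simp; field_simp

lemma mpc_subspace {k : Type*} [Field k] [IsAlgClosed k] {ι : Type*} [Fintype ι] {m : ℕ}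
    (G : Fin m → MvPolynomial ι k) (hG : ∀ j, (G j).IsHomogeneous ((j : ℕ) + 1))
    (L : Submodule k (ι → k)) (ξ : ι → k) (hξ : ∀ j, eval ξ (G j) = 0) (T : ℕ)
    (hL : T + m * (m + 1) ^ T < Module.finrank k L) :
    ∀ t ≤ T, ∃ v : Fin t → ι → k, LinearIndependent k v ∧ (∀ a, v a ∈ L) ∧
      ∀ x ∈ Submodule.span k {ξ} ⊔ Submodule.span k (Set.range v), ∀ j, eval x (G j) = 0 := by
  intro t
  induction t with
  | zero =>
    intro _
    refine ⟨Fin.elim0, linearIndependent_empty_type, fun a => a.elim0, ?_⟩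
    intro x hx j
    rw [Set.range_eq_empty, Submodule.span_empty, sup_bot_eq] at hx
    obtain ⟨c, rfl⟩ := Submodule.mem_span_singleton.mp hx
    have := mpc_eval_smul (hG j) c ξ
    rw [hξ, mul_zero] at this
    exact this
  | succ t ih =>
    intro ht
    obtain ⟨v, hv1, hv2, hv3⟩ := ih (by omega)
    set P := Submodule.span k {ξ} ⊔ Submodule.span k (Set.range v) with hP
    have hfr : Module.finrank k P ≤ t + 1 := by
      refine (Submodule.finrank_add_le_finrank_add_finrank _ _).trans ?_
      have h1 : Module.finrank k (Submodule.span k {ξ}) ≤ 1 := (finrank_span_le_card {ξ}).trans (by simp)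
      have h2 := finrank_range_le_card (R := k) v
      rw [Set.finrank] at h2
      simp at h2
      omega
    obtain ⟨w, hwL, hwP, hw⟩ := mpc_extend G hG P L _ rfl hv3 (by
      have : m * (m + 1) ^ (Module.finrank k P) ≤ m * (m + 1) ^ T :=
        Nat.mul_le_mul_left _ (Nat.pow_le_pow_right (by omega) (by omega))
      omega)
    refine ⟨Fin.cons w v, ?_, ?_, ?_⟩
    · rw [linearIndependent_finCons]
      refine ⟨hv1, fun h => hwP ?_⟩
      exact (le_sup_right : _ ≤ P) h
    · intro a
      refine Fin.cases ?_ ?_ a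
      · simpa using hwL
      · intro i; simpa using hv2 i
    · intro x hx j
      refine hw x ?_ j
      refine (?_ : _ ≤ P ⊔ Submodule.span k {w}) hx
      rw [Fin.range_cons, Submodule.span_insert]
      refine sup_le (le_sup_left.trans le_sup_left) (sup_le le_sup_right (le_sup_right.trans le_sup_left))

section shear

set_option linter.unusedSimpArgs false
set_option linter.unusedSectionVars false

variable {ι R : Type*} [CommRing R] (s : ι)

/-- The substitution `X a ↦ X a + c a * X s`. -/
noncomputable def mpcShear (c : ι → R) : MvPolynomial ι R →ₐ[R] MvPolynomial ι R :=
  aeval (fun a => X a + C (c a) * X s)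

lemma mpcShear_comp (c c' : ι → R) (hc' : c' s = 0) (p : MvPolynomial ι R) :
    mpcShear s c' (mpcShear s c p) = mpcShear s (c + c') p := by
  have : (mpcShear s c').comp (mpcShear s c) = mpcShear s (c + c') := by
    apply MvPolynomial.algHom_ext
    intro a
    simp [mpcShear, hc', algHom_C, MvPolynomial.algebraMap_eq]
    ring
  exact congrArg (fun φ => φ p) this

lemma mpcShear_zero (p : MvPolynomial ι R) : mpcShear s (0 : ι → R) p = p := by
  simp [mpcShear]

lemma mpcShear_monomial_add [DecidableEq ι] (c : ι → R) (μ : ι →₀ ℕ) (a : ι) (ν : ι →₀ ℕ) :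
    coeff ν (mpcShear s c (monomial (μ + Finsupp.single a 1) 1)) =
      (if a ∈ ν.support then coeff (ν - Finsupp.single a 1) (mpcShear s c (monomial μ 1)) else 0) +
      c a * (if s ∈ ν.support then coeff (ν - Finsupp.single s 1) (mpcShear s c (monomial μ 1))
        else 0) := by
  have h1 : (monomial (μ + Finsupp.single a 1) 1 : MvPolynomial ι R) = monomial μ 1 * X a := by
    rw [X, monomial_mul, mul_one]
  have h2 : mpcShear s c (X a) = X a + C (c a) * X s := by simp [mpcShear]
  rw [h1, map_mul, h2, mul_add, coeff_add, coeff_mul_X']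
  congr 1
  rw [mul_left_comm, coeff_C_mul, coeff_mul_X']


lemma mpc_finsupp_ind {P : (ι →₀ ℕ) → Prop} (h0 : P 0)
    (h1 : ∀ μ a, P μ → P (μ + Finsupp.single a 1)) (μ : ι →₀ ℕ) : P μ := by
  induction μ using Finsupp.induction_linear with
  | zero => exact h0
  | add f g hf hg =>
    clear hf
    induction f using Finsupp.induction_linear generalizing g with
    | zero => simpa using hg
    | add f f' hf hf' => rw [add_assoc]; exact hf _ (hf' _ hg)
    | single a b =>
      induction b with
      | zero => simpa using hg
      | succ b ih =>
        have := h1 _ a ih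
        rwa [add_right_comm, ← Finsupp.single_add] at this
  | single a b =>
    induction b with
    | zero => simpa using h0
    | succ b ih => rw [Finsupp.single_add]; exact h1 _ _ ih

/-- The monomials which vanish in the normal form. -/
def mpcBad (lev : ι → ℕ) (μ : ι →₀ ℕ) : Prop := ∀ i, i ≠ s → μ i ≠ 0 → μ s + 1 ≤ lev i

variable [Fintype ι]

/-- Which monomials can occur in a shear of a monomial. -/
lemma mpcShear_support (c : ι → R) (hc : c s = 0) (μ ν : ι →₀ ℕ)
    (h : coeff ν (mpcShear s c (monomial μ 1)) ≠ 0) :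
    (∀ a, a ≠ s → ν a ≤ μ a ∧ (c a = 0 → ν a = μ a)) ∧ ∑ a, ν a = ∑ a, μ a := by
  classical
  revert ν
  refine mpc_finsupp_ind (P := fun μ => ∀ ν, coeff ν (mpcShear s c (monomial μ 1)) ≠ 0 →
    (∀ a, a ≠ s → ν a ≤ μ a ∧ (c a = 0 → ν a = μ a)) ∧ ∑ a, ν a = ∑ a, μ a) ?_ ?_ μ
  · intro ν h
    have h1 : (monomial 0 1 : MvPolynomial ι R) = 1 := rfl
    rw [h1, map_one, coeff_one] at h
    have : ν = 0 := by
      by_contra h'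
      exact h (if_neg fun h2 => h' h2.symm)
    subst this
    simp
  · intro μ a ih ν h
    rw [mpcShear_monomial_add] at h
    have hsum : ∀ (x : ι), x ∈ ν.support → ∑ b, ν b = ∑ b, (ν - Finsupp.single x 1 : ι →₀ ℕ) b + 1 := by
      intro x hx
      have : ν = (ν - Finsupp.single x 1) + Finsupp.single x 1 := by
        rw [tsub_add_cancel_of_le]
        rw [Finsupp.single_le_iff]
        exact Nat.one_le_iff_ne_zero.mpr (Finsupp.mem_support_iff.mp hx)
      conv_lhs => rw [this]
      simp only [Finsupp.add_apply, Finset.sum_add_distrib]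
      simp [Finsupp.single_apply]
    have hsum2 : ∑ b, (μ + Finsupp.single a 1 : ι →₀ ℕ) b = ∑ b, μ b + 1 := by
      simp only [Finsupp.add_apply, Finset.sum_add_distrib]
      simp [Finsupp.single_apply]
    by_cases h1 : (if a ∈ ν.support then coeff (ν - Finsupp.single a 1)
        (mpcShear s c (monomial μ 1)) else 0) = 0
    · rw [h1, zero_add] at h
      have hca : c a ≠ 0 := left_ne_zero_of_mul h
      have h2 := right_ne_zero_of_mul h
      by_cases hs : s ∈ ν.support
      · rw [if_pos hs] at h2
        obtain ⟨h3, h4⟩ := ih _ h2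
        refine ⟨?_, by rw [hsum s hs, h4, hsum2]⟩
        intro b hb
        have h5 := h3 b hb
        simp only [Finsupp.tsub_apply, Finsupp.add_apply, Finsupp.single_apply] at h5 ⊢
        rw [if_neg (Ne.symm hb)] at h5
        by_cases hab : a = b
        · subst hab; simp [hca]; omega
        · simpa [hab] using h5
      · rw [if_neg hs] at h2; exact absurd rfl h2
    · by_cases hs : a ∈ ν.support
      · rw [if_pos hs] at h1
        obtain ⟨h3, h4⟩ := ih _ h1
        refine ⟨?_, by rw [hsum a hs, h4, hsum2]⟩
        intro b hb
        have h5 := h3 b hb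
        have h6 := Finsupp.mem_support_iff.mp hs
        simp only [Finsupp.tsub_apply, Finsupp.add_apply, Finsupp.single_apply] at h5 ⊢
        by_cases hab : a = b
        · subst hab; simp at h5 ⊢; 
          refine ⟨by omega, fun h => ?_⟩
          have := h5.2 h
          omega
        · simpa [hab] using h5
      · rw [if_neg hs] at h1; exact absurd rfl h1

lemma mpcShear_coeff_self (c : ι → R) (hc : c s = 0) (μ : ι →₀ ℕ) :
    coeff μ (mpcShear s c (monomial μ 1)) = 1 := by
  classical
  refine mpc_finsupp_ind (P := fun μ => coeff μ (mpcShear s c (monomial μ 1)) = 1) ?_ ?_ μ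
  · have h1 : (monomial 0 1 : MvPolynomial ι R) = 1 := rfl
    rw [h1, map_one, coeff_one, if_pos rfl]
  · intro μ a ih
    rw [mpcShear_monomial_add, if_pos (by simp), add_tsub_cancel_right, ih]
    by_cases ha : a = s
    · subst ha; simp [hc]
    · have : (if s ∈ (μ + Finsupp.single a 1).support then
          coeff (μ + Finsupp.single a 1 - Finsupp.single s 1) (mpcShear s c (monomial μ 1))
          else 0) = 0 := by
        split_ifs with h
        · by_contra h1
          have := (mpcShear_support s c hc _ _ h1).1 a ha
          simp [Finsupp.single_apply, Ne.symm ha] at this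
        · rfl
      rw [this]; simp

lemma mpcShear_coeff_one (c : ι → R) (hc : c s = 0) (ν : ι →₀ ℕ) (a : ι) (ha : a ≠ s)
    (hν : ν a = 0) :
    coeff (ν + Finsupp.single s 1) (mpcShear s c (monomial (ν + Finsupp.single a 1) 1)) = c a := by
  classical
  rw [mpcShear_monomial_add, if_neg (by simp [hν, ha]), if_pos (by simp),
    add_tsub_cancel_right, mpcShear_coeff_self s c hc]
  simp

lemma mpcShear_coeff (c : ι → R) (p : MvPolynomial ι R) (ν : ι →₀ ℕ) :
    coeff ν (mpcShear s c p) = ∑ μ ∈ p.support, coeff μ p * coeff ν (mpcShear s c (monomial μ 1)) := by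
  conv_lhs => rw [p.as_sum, map_sum, coeff_sum]
  refine Finset.sum_congr rfl fun μ _ => ?_
  have : (monomial μ (coeff μ p) : MvPolynomial ι R) = C (coeff μ p) * monomial μ 1 := by
    rw [C_mul_monomial, mul_one]
  rw [this, map_mul, algHom_C, MvPolynomial.algebraMap_eq, coeff_C_mul]

lemma mpcShear_low (lev : ι → ℕ) (c : ι → R) (i : ℕ) (hc : c s = 0)
    (hci : ∀ a, lev a < i → c a = 0) (p : MvPolynomial ι R)
    (hp : ∀ μ, mpcBad s lev μ → coeff μ p = 0) (ν : ι →₀ ℕ)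
    (h1 : ∀ a, a ≠ s → ν a ≠ 0 → i ≤ lev a) (h2 : ν s ≤ i) :
    coeff ν (mpcShear s c p) = coeff ν p := by
  classical
  rw [mpcShear_coeff, Finset.sum_eq_single ν, mpcShear_coeff_self s c hc, mul_one]
  · intro μ hμ hne
    by_contra h
    have hnb : ¬ mpcBad s lev μ := fun hb => left_ne_zero_of_mul h (hp μ hb)
    obtain ⟨h3, h4⟩ := mpcShear_support s c hc _ _ (right_ne_zero_of_mul h)
    rw [mpcBad] at hnb
    push Not at hnb
    obtain ⟨b, hb, hb0, hb1⟩ := hnb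
    rw [← Finset.add_sum_erase _ _ (Finset.mem_univ s), ← Finset.add_sum_erase _ (fun a => μ a) (Finset.mem_univ s)] at h4
    have h5 : ∑ a ∈ Finset.univ.erase s, ν a ≤ ∑ a ∈ Finset.univ.erase s, μ a :=
      Finset.sum_le_sum fun a ha => (h3 a (Finset.ne_of_mem_erase ha)).1
    have h6 : i ≤ lev b := by
      by_contra h7
      exact h7 (h1 b hb (by rw [(h3 b hb).2 (hci b (by omega))]; exact hb0))
    have h8 : ∑ a ∈ Finset.univ.erase s, ν a = ∑ a ∈ Finset.univ.erase s, μ a := by omega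
    have h9 := (Finset.sum_eq_sum_iff_of_le (fun a ha => (h3 a (Finset.ne_of_mem_erase ha)).1)).mp h8
    apply hne
    ext a
    by_cases ha : a = s
    · subst ha; omega
    · exact (h9 a (Finset.mem_erase.mpr ⟨ha, Finset.mem_univ _⟩)).symm
  · intro h
    simp [notMem_support_iff.mp h]

lemma mpcShear_high [DecidableEq ι] (lev : ι → ℕ) (c : ι → R) (i : ℕ) (hc : c s = 0)
    (hci : ∀ a, lev a < i → c a = 0) (p : MvPolynomial ι R)
    (hp : ∀ μ, mpcBad s lev μ → coeff μ p = 0) (ν : ι →₀ ℕ)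
    (h1 : ∀ a, a ≠ s → ν a ≠ 0 → i + 2 ≤ lev a) (h2 : ν s = i) :
    coeff (ν + Finsupp.single s 1) (mpcShear s c p) =
      ∑ a ∈ Finset.univ.filter (fun a => a ≠ s ∧ lev a = i),
        c a * coeff (ν + Finsupp.single a 1) p := by
  rw [mpcShear_coeff]
  have hinj : Set.InjOn (fun a => ν + Finsupp.single a 1)
      ((Finset.univ.filter (fun a => a ≠ s ∧ lev a = i) : Finset ι) : Set ι) := by
    intro a _ b _ hab
    have := add_left_cancel hab
    exact (Finsupp.single_left_inj one_ne_zero).mp this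
  have key : ∑ a ∈ Finset.univ.filter (fun a => a ≠ s ∧ lev a = i),
        c a * coeff (ν + Finsupp.single a 1) p =
      ∑ μ ∈ (Finset.univ.filter (fun a => a ≠ s ∧ lev a = i)).image (fun a => ν + Finsupp.single a 1),
        coeff μ p * coeff (ν + Finsupp.single s 1) (mpcShear s c (monomial μ 1)) := by
    rw [Finset.sum_image hinj]
    refine Finset.sum_congr rfl fun a ha => ?_
    obtain ⟨-, ha1, ha2⟩ := Finset.mem_filter.mp ha
    rw [mpcShear_coeff_one s c hc ν a ha1, mul_comm]
    by_contra h
    have := h1 a ha1 h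
    omega
  rw [key]
  have hb : ∀ μ, coeff μ p * coeff (ν + Finsupp.single s 1) (mpcShear s c (monomial μ 1)) ≠ 0 →
      μ ∈ (Finset.univ.filter (fun a => a ≠ s ∧ lev a = i)).image (fun a => ν + Finsupp.single a 1) := by
    intro μ h
    have hnb : ¬ mpcBad s lev μ := fun hb => left_ne_zero_of_mul h (hp μ hb)
    obtain ⟨h3, h4⟩ := mpcShear_support s c hc _ _ (right_ne_zero_of_mul h)
    rw [mpcBad] at hnb
    push Not at hnb
    obtain ⟨b, hb, hb0, hb1⟩ := hnb
    have h3' : ∀ a, a ≠ s → ν a ≤ μ a ∧ (c a = 0 → ν a = μ a) := by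
      intro a ha
      have := h3 a ha
      simpa [Finsupp.single_apply, Ne.symm ha] using this
    have hbs : b ∈ Finset.univ.erase s := Finset.mem_erase.mpr ⟨hb, Finset.mem_univ _⟩
    rw [← Finset.add_sum_erase _ _ (Finset.mem_univ s),
      ← Finset.add_sum_erase _ (fun a => μ a) (Finset.mem_univ s),
      ← Finset.add_sum_erase _ _ hbs, ← Finset.add_sum_erase _ (fun a => μ a) hbs] at h4
    have h4' : ν s + 1 + (ν b + ∑ a ∈ (Finset.univ.erase s).erase b, ν a) =
        μ s + (μ b + ∑ a ∈ (Finset.univ.erase s).erase b, μ a) := by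
      rw [← h4]
      congr 1
      · simp
      · congr 1
        · simp [Finsupp.single_apply, Ne.symm hb]
        · refine Finset.sum_congr rfl fun a ha => ?_
          have := Finset.ne_of_mem_erase (Finset.mem_of_mem_erase ha)
          simp [Finsupp.single_apply, Ne.symm this]
    have hle : ∀ a ∈ (Finset.univ.erase s).erase b, ν a ≤ μ a := fun a ha =>
      (h3' a (Finset.ne_of_mem_erase (Finset.mem_of_mem_erase ha))).1
    have h5 := Finset.sum_le_sum hle
    have hνb : ν b = 0 := by
      by_contra h6
      have := h1 b hb h6
      have h7 := (h3' b hb).1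
      omega
    have hcb : i ≤ lev b := by
      by_contra h6
      have := (h3' b hb).2 (hci b (by omega))
      omega
    have h8 : ∑ a ∈ (Finset.univ.erase s).erase b, ν a = ∑ a ∈ (Finset.univ.erase s).erase b, μ a := by omega
    have h9 := (Finset.sum_eq_sum_iff_of_le hle).mp h8
    refine Finset.mem_image.mpr ⟨b, Finset.mem_filter.mpr ⟨Finset.mem_univ _, hb, by omega⟩, ?_⟩
    ext a
    by_cases ha : a = s
    · subst ha
      simp [Finsupp.single_apply, hb]; omega
    · by_cases hab : a = b
      · subst hab; simp; omega
      · have := h9 a (by simp [ha, hab])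
        simp [Finsupp.single_apply, Ne.symm hab, this]
  symm
  refine Finset.sum_congr_of_eq_on_inter ?_ ?_ ?_
  · intro μ h6 h7
    simp [notMem_support_iff.mp h7]
  · intro μ h6 h7
    by_contra h
    exact h7 (hb μ h)
  · intros; rfl

end shear

lemma mpc_mem_range_map {Ω σ : Type*} [Field Ω] (S : Subfield Ω) (p : MvPolynomial σ Ω) :
    p ∈ (MvPolynomial.map (σ := σ) S.subtype).range ↔ ∀ μ, coeff μ p ∈ S := by
  constructor
  · rintro ⟨p, rfl⟩ μ
    rw [coeff_map]
    exact (coeff μ p).2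
  · intro h
    rw [p.as_sum]
    refine Subring.sum_mem _ fun μ _ => ⟨monomial μ ⟨coeff μ p, h μ⟩, ?_⟩
    simp

lemma mpc_coeff_mem {Ω ι σ : Type*} [Field Ω] (S : Subfield Ω)
    (g : ι → MvPolynomial σ Ω) (hg : ∀ i μ, coeff μ (g i) ∈ S)
    (p : MvPolynomial ι Ω) (hp : ∀ μ, coeff μ p ∈ S) (ν : σ →₀ ℕ) :
    coeff ν (aeval g p) ∈ S := by
  revert ν
  rw [← mpc_mem_range_map, aeval_def, eval₂_eq]
  refine Subring.sum_mem _ fun μ _ => Subring.mul_mem _ ?_ (Subring.prod_mem _ fun i _ =>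
    Subring.pow_mem _ ((mpc_mem_range_map S _).mpr (hg i)) _)
  exact ⟨C ⟨coeff μ p, hp μ⟩, by simp⟩

lemma mpc_solve {Ω n : Type*} [Field Ω] [Fintype n] [DecidableEq n] (S : Subfield Ω)
    (M : Matrix n n Ω) (hM : ∀ i j, M i j ∈ S) (hdet : M.det ≠ 0) (v : n → Ω)
    (hv : ∀ i, (∑ j, M i j * v j) ∈ S) (i : n) : v i ∈ S := by
  have hdS : M.det ∈ S := by
    rw [Matrix.det_apply]
    refine Subfield.sum_mem _ fun σ _ => ?_
    rw [Units.smul_def]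
    exact zsmul_mem (Subfield.prod_mem _ fun i _ => hM _ _) _
  have hadj : ∀ a b, M.adjugate a b ∈ S := by
    intro a b
    rw [Matrix.adjugate_apply, Matrix.det_apply]
    refine Subfield.sum_mem _ fun σ _ => ?_
    rw [Units.smul_def]
    refine zsmul_mem (Subfield.prod_mem _ fun i _ => ?_) _
    rw [Matrix.updateRow_apply]
    split_ifs
    · rw [Pi.single_apply]
      split_ifs
      · exact S.one_mem
      · exact S.zero_mem
    · exact hM _ _
  have h1 : M.adjugate.mulVec (M.mulVec v) = M.det • v := by
    rw [Matrix.mulVec_mulVec, Matrix.adjugate_mul, Matrix.smul_mulVec, Matrix.one_mulVec]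
  have h2 : v i = M.det⁻¹ * (M.adjugate.mulVec (M.mulVec v)) i := by
    rw [h1]; simp [hdet]
  rw [h2]
  refine S.mul_mem (S.inv_mem hdS) ?_
  exact Subfield.sum_mem _ fun j _ => S.mul_mem (hadj _ _) (hv j)

/-- Index set of equations which must be solved. -/
abbrev MpcE {ι : Type*} [Fintype ι] (s : ι) (lev : ι → ℕ) (m : ℕ) : Type _ :=
  {x : Fin m × (ι →₀ ℕ) // ∑ i, x.2 i = (x.1 : ℕ) + 1 ∧ mpcBad s lev x.2 ∧ x.2 s ≠ 0}

set_option linter.unusedSimpArgs false in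
lemma mpc_gen_pivot {Ω ι : Type*} [Field Ω] [Fintype ι] [DecidableEq ι] (S : Subfield Ω)
    (s : ι) (lev : ι → ℕ) (m : ℕ) (p : Fin m → MvPolynomial ι Ω)
    (hp : ∀ j μ, mpcBad s lev μ → coeff μ (p j) = 0)
    (ω : ι → Ω) (hω : ω s = 0)
    (hF : ∀ j ν, coeff ν (mpcShear s (-ω) (p j)) ∈ S)
    [Fintype (MpcE s lev m)] [DecidableEq (MpcE s lev m)] (e : MpcE s lev m → ι)
    (he : Function.Injective e)
    (hes : ∀ ε, e ε ≠ s) (hel : ∀ ε, lev (e ε) + 1 = ε.1.2 s)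
    (hnon : ∀ a, a ∉ Set.range e → ω a ∈ S)
    (hdet : ∀ i : ℕ, (Matrix.of (fun ε ε' : {ε : MpcE s lev m // ε.1.2 s = i + 1} =>
      coeff (ε.1.1.2 - Finsupp.single s 1 + Finsupp.single (e ε'.1) 1) (p ε.1.1.1))).det ≠ 0) :
    ∀ a, ω a ∈ S := by
  have key : ∀ i : ℕ, ∀ a, lev a < i → ω a ∈ S := by
    intro i
    induction i with
    | zero => intro a ha; omega
    | succ i ih =>
      -- split the shear
      let ωl : ι → Ω := fun a => if lev a < i then ω a else 0
      let ωh : ι → Ω := fun a => if lev a < i then 0 else - ω a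
      have hωl : ωl s = 0 := by simp [ωl, hω]
      have hωh : ωh s = 0 := by simp [ωh, hω]
      have hωh2 : ∀ a, lev a < i → ωh a = 0 := fun a ha => by simp [ωh, ha]
      have hP : ∀ j, mpcShear s ωh (p j) = mpcShear s ωl (mpcShear s (-ω) (p j)) := by
        intro j
        rw [mpcShear_comp s _ _ hωl]
        congr 2
        ext a
        simp only [ωh, ωl, Pi.add_apply, Pi.neg_apply]
        split_ifs <;> simp
      have hPS : ∀ j ν, coeff ν (mpcShear s ωh (p j)) ∈ S := by
        intro j ν
        rw [hP]
        refine mpc_coeff_mem S _ ?_ _ (hF j) ν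
        intro a
        rw [← mpc_mem_range_map]
        refine Subring.add_mem _ ⟨X a, by simp⟩ (Subring.mul_mem _ ?_ ⟨X s, by simp⟩)
        refine ⟨C ⟨ωl a, ?_⟩, by simp⟩
        simp only [ωl]
        split_ifs with h
        · exact ih a h
        · exact S.zero_mem
      have hM : ∀ (ε : {ε : MpcE s lev m // ε.1.2 s = i + 1}) (a : ι), a ≠ s → lev a = i →
          coeff (ε.1.1.2 - Finsupp.single s 1 + Finsupp.single a 1) (p ε.1.1.1) ∈ S := by
        intro ε a ha hl
        rw [← mpcShear_low s lev ωh i hωh hωh2 (p ε.1.1.1) (hp _)]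
        · exact hPS _ _
        · intro b hb h
          by_cases hab : a = b
          · subst hab; exact hl.ge
          · have h3 := ε.1.2.2.1 b hb (by
              simpa [Finsupp.single_apply, Ne.symm hb, hab] using h)
            omega
        · have := ε.2
          simp [Finsupp.single_apply, ha]; omega
      have hsys : ∀ (ε : {ε : MpcE s lev m // ε.1.2 s = i + 1}),
          coeff ε.1.1.2 (mpcShear s ωh (p ε.1.1.1)) =
          ∑ a ∈ Finset.univ.filter (fun a => a ≠ s ∧ lev a = i),
            ωh a * coeff (ε.1.1.2 - Finsupp.single s 1 + Finsupp.single a 1) (p ε.1.1.1) := by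
        intro ε
        have h1 : ε.1.1.2 - Finsupp.single s 1 + Finsupp.single s 1 = ε.1.1.2 := by
          rw [tsub_add_cancel_of_le]
          rw [Finsupp.single_le_iff, ε.2]; omega
        rw [← mpcShear_high s lev ωh i hωh hωh2 (p ε.1.1.1) (hp _), h1]
        · intro a ha h
          have h3 := ε.1.2.2.1 a ha (by simpa [Finsupp.single_apply, Ne.symm ha] using h)
          have := ε.2
          omega
        · have := ε.2
          simp; omega
      have hpiv : ∀ (ε : {ε : MpcE s lev m // ε.1.2 s = i + 1}), ωh (e ε.1) ∈ S := by
        refine mpc_solve S _ ?_ (hdet i) (fun ε => ωh (e ε.1)) ?_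
        · intro ε ε'
          have := hel ε'.1
          have h2 := ε'.2
          exact hM ε _ (hes _) (by omega)
        · intro ε
          have h1 := hsys ε
          rw [← Finset.sum_filter_add_sum_filter_not _ (fun a => a ∈ Set.range e)] at h1
          have h2 : ∑ ε' : {ε : MpcE s lev m // ε.1.2 s = i + 1},
              Matrix.of (fun ε ε' : {ε : MpcE s lev m // ε.1.2 s = i + 1} =>
                coeff (ε.1.1.2 - Finsupp.single s 1 + Finsupp.single (e ε'.1) 1) (p ε.1.1.1)) ε ε' * ωh (e ε'.1)
              = ∑ a ∈ (Finset.univ.filter (fun a => a ≠ s ∧ lev a = i)).filter (fun a => a ∈ Set.range e),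
                ωh a * coeff (ε.1.1.2 - Finsupp.single s 1 + Finsupp.single a 1) (p ε.1.1.1) := by
            refine Finset.sum_bij (fun ε' _ => e ε'.1) ?_ ?_ ?_ ?_
            · intro ε' _
              have := hel ε'.1
              have h2 := ε'.2
              simp only [Finset.mem_filter, Finset.mem_univ, true_and]
              exact ⟨⟨hes _, by omega⟩, ⟨_, rfl⟩⟩
            · intro a _ b _ hab
              exact Subtype.ext (he hab)
            · intro a ha
              simp only [Finset.mem_filter, Finset.mem_univ, true_and] at ha
              obtain ⟨⟨ha1, ha2⟩, ε', rfl⟩ := ha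
              exact ⟨⟨ε', by rw [← hel, ha2]⟩, Finset.mem_univ _, rfl⟩
            · intro ε' _
              simp [mul_comm]
          rw [h2, eq_sub_iff_add_eq.mpr h1.symm]
          refine S.sub_mem (hPS _ _) (Subfield.sum_mem _ fun a ha => ?_)
          simp only [Finset.mem_filter, Finset.mem_univ, true_and] at ha
          refine S.mul_mem ?_ (hM ε a ha.1.1 ha.1.2)
          simp only [ωh]
          rw [if_neg (by omega)]
          exact S.neg_mem (hnon a ha.2)
      intro a ha
      by_cases hr : a ∈ Set.range e
      · obtain ⟨ε, rfl⟩ := hr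
        by_cases hi : lev (e ε) < i
        · exact ih _ hi
        · have := hpiv ⟨ε, by rw [← hel]; omega⟩
          simp only [ωh, if_neg hi] at this
          simpa using S.neg_mem this
      · exact hnon a hr
  intro a
  exact key (lev a + 1) a (Nat.lt_succ_self _)

section generic

set_option linter.unusedSectionVars false

variable {ι : Type*} [Fintype ι] [DecidableEq ι]

section basics

variable {R R' : Type*} [CommRing R] [CommRing R']

/-- Linear substitution. -/
noncomputable def mpcSub (M : Matrix ι ι R) : MvPolynomial ι R →ₐ[R] MvPolynomial ι R :=
  aeval (fun i => ∑ k, C (M i k) * X k)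

lemma mpcSub_mpcSub (M N : Matrix ι ι R) (p : MvPolynomial ι R) :
    mpcSub N (mpcSub M p) = mpcSub (M * N) p := by
  have : (mpcSub N).comp (mpcSub M) = mpcSub (M * N) := by
    apply MvPolynomial.algHom_ext
    intro i
    simp only [mpcSub, AlgHom.comp_apply, aeval_X, map_sum, map_mul, algHom_C,
      MvPolynomial.algebraMap_eq, Matrix.mul_apply, Finset.mul_sum, Finset.sum_mul]
    rw [Finset.sum_comm]
    simp only [mul_assoc]
  exact congrArg (fun φ => φ p) this

lemma mpcSub_one (p : MvPolynomial ι R) : mpcSub (1 : Matrix ι ι R) p = p := by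
  have : mpcSub (1 : Matrix ι ι R) = AlgHom.id R _ := by
    apply MvPolynomial.algHom_ext
    intro i
    simp [mpcSub, Matrix.one_apply]
  rw [this]; rfl

lemma mpcSub_shear (s : ι) (c : ι → R) (p : MvPolynomial ι R) :
    mpcSub (1 + Matrix.vecMulVec c (Pi.single s 1)) p = mpcShear s c p := by
  have : mpcSub (1 + Matrix.vecMulVec c (Pi.single s 1)) = mpcShear s c := by
    apply MvPolynomial.algHom_ext
    intro i
    simp [mpcSub, mpcShear, Matrix.one_apply, Matrix.vecMulVec_apply, add_mul,
      Finset.sum_add_distrib, Pi.single_apply, apply_ite C]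
  rw [this]

lemma mpcSub_map (f : R →+* R') (M : Matrix ι ι R) (p : MvPolynomial ι R) :
    map f (mpcSub M p) = mpcSub (M.map f) (map f p) := by
  have : (map f).comp (mpcSub M).toRingHom = (mpcSub (M.map f)).toRingHom.comp (map f) := by
    apply MvPolynomial.ringHom_ext
    · intro r; simp [algHom_C, MvPolynomial.algebraMap_eq]
    · intro i; simp [mpcSub]
  exact congrArg (fun φ => φ p) this

lemma mpcSub_eval (M : Matrix ι ι R) (x : ι → R) (p : MvPolynomial ι R) :
    eval x (mpcSub M p) = eval (M.mulVec x) p := by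
  have : (eval x).comp (mpcSub M).toRingHom = eval (M.mulVec x) := by
    apply MvPolynomial.ringHom_ext
    · intro r; simp [algHom_C, MvPolynomial.algebraMap_eq]
    · intro i; simp [mpcSub, Matrix.mulVec, dotProduct]
  exact congrArg (fun φ => φ p) this

lemma mpcSub_homog (M : Matrix ι ι R) {n : ℕ} (p : MvPolynomial ι R) (hp : p.IsHomogeneous n) :
    (mpcSub M p).IsHomogeneous n := by
  have := hp.aeval (fun i => ∑ k, C (M i k) * X k : ι → MvPolynomial ι R) (n := 1) (fun i =>
    IsHomogeneous.sum _ _ _ fun k _ => isHomogeneous_C_mul_X _ _)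
  simpa [mpcSub] using this

/-- The form with given coefficients. -/
noncomputable def mpcForm (n : ℕ) (cf : (ι →₀ ℕ) → R) : MvPolynomial ι R :=
  ∑ μ ∈ Finset.finsuppAntidiag Finset.univ n, monomial μ (cf μ)

lemma mpcForm_coeff (n : ℕ) (cf : (ι →₀ ℕ) → R) (ν : ι →₀ ℕ) :
    coeff ν (mpcForm n cf) = if ∑ i, ν i = n then cf ν else 0 := by
  rw [mpcForm, coeff_sum]
  simp only [coeff_monomial]
  rw [Finset.sum_ite_eq']
  simp

lemma mpc_homog_sum {n : ℕ} {p : MvPolynomial ι R} (hp : p.IsHomogeneous n) {μ : ι →₀ ℕ}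
    (h : coeff μ p ≠ 0) : ∑ i, μ i = n := by
  have := hp h
  rw [← this, Finsupp.weight_apply, Finsupp.sum_fintype _ _ (by simp)]
  simp

lemma mpcForm_homog (n : ℕ) (cf : (ι →₀ ℕ) → R) : (mpcForm n cf).IsHomogeneous n := by
  intro μ h
  rw [mpcForm_coeff] at h
  have h1 : ∑ i, μ i = n := by
    by_contra h2
    exact h (if_neg h2)
  rw [← h1, Finsupp.weight_apply, Finsupp.sum_fintype _ _ (by simp)]
  simp

end basics

variable (s : ι) (lev : ι → ℕ) (m : ℕ)

/-- Index set of the coefficients of the normal form. -/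
abbrev MpcC : Type _ :=
  {x : Fin m × (ι →₀ ℕ) // ∑ i, x.2 i = (x.1 : ℕ) + 1 ∧ ¬ mpcBad s lev x.2}

abbrev MpcLt : Type _ := {i : ι // lev i ≠ 0}

abbrev MpcJ : Type _ := (MpcLt lev × MpcLt lev) ⊕ {i : ι // i ≠ s} ⊕ MpcC s lev m

variable {R R' : Type*} [CommRing R] [CommRing R']

variable {m} {s lev}

noncomputable def mpcH (z : MpcJ s lev m → R) : Matrix ι ι R :=
  Matrix.of fun i k => if h : lev i ≠ 0 ∧ lev k ≠ 0 then z (Sum.inl (⟨i, h.1⟩, ⟨k, h.2⟩))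
    else if i = k then 1 else 0

noncomputable def mpcOm (z : MpcJ s lev m → R) : ι → R :=
  fun i => if h : i ≠ s then z (Sum.inr (Sum.inl ⟨i, h⟩)) else 0

noncomputable def mpcA (z : MpcJ s lev m → R) : Matrix ι ι R :=
  (1 + Matrix.vecMulVec (-mpcOm z) (Pi.single s 1)) * mpcH z

open Classical in
noncomputable def mpcG2 (z : MpcJ s lev m → R) (j : Fin m) : MvPolynomial ι R :=
  mpcForm ((j : ℕ) + 1) (fun μ =>
    if h : (∑ i, μ i = (j : ℕ) + 1 ∧ ¬ mpcBad s lev μ) then z (Sum.inr (Sum.inr ⟨(j, μ), h⟩)) else 0)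

noncomputable def mpcG (z : MpcJ s lev m → R) (j : Fin m) : MvPolynomial ι R :=
  mpcSub (mpcA z) (mpcG2 z j)

noncomputable def mpcXi (z : MpcJ s lev m → R) : ι → R := fun i => (mpcA z).adjugate i s

variable (z : MpcJ s lev m → R)

lemma mpcG2_coeff (j : Fin m) (μ : ι →₀ ℕ) (h : ∑ i, μ i = (j : ℕ) + 1 ∧ ¬ mpcBad s lev μ) :
    coeff μ (mpcG2 z j) = z (Sum.inr (Sum.inr ⟨(j, μ), h⟩)) := by
  rw [mpcG2, mpcForm_coeff, if_pos h.1, dif_pos h]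

lemma mpcG2_coeff_bad (j : Fin m) (μ : ι →₀ ℕ) (h : mpcBad s lev μ) :
    coeff μ (mpcG2 z j) = 0 := by
  rw [mpcG2, mpcForm_coeff, dif_neg (fun h' => h'.2 h), ite_self]

lemma mpcG2_homog (j : Fin m) : (mpcG2 z j).IsHomogeneous ((j : ℕ) + 1) := mpcForm_homog _ _

lemma mpcG_homog (j : Fin m) : (mpcG z j).IsHomogeneous ((j : ℕ) + 1) :=
  mpcSub_homog _ _ (mpcG2_homog z j)

lemma mpcH_map (f : R →+* R') : (mpcH z).map f = mpcH (f ∘ z) := by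
  ext i k
  simp only [mpcH, Matrix.map_apply, Matrix.of_apply]
  split_ifs <;> simp

lemma mpcOm_map (f : R →+* R') : f ∘ (mpcOm z) = mpcOm (f ∘ z) := by
  ext i
  simp only [mpcOm, Function.comp]
  split_ifs <;> simp

lemma mpcA_map (f : R →+* R') : (mpcA z).map f = mpcA (f ∘ z) := by
  rw [mpcA, mpcA, Matrix.map_mul, mpcH_map, ← mpcOm_map]
  congr 1
  ext i k
  simp [Matrix.one_apply, Matrix.vecMulVec_apply, Pi.single_apply, apply_ite f]

lemma mpcG2_map (f : R →+* R') (j : Fin m) : map f (mpcG2 z j) = mpcG2 (f ∘ z) j := by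
  ext μ
  rw [coeff_map]
  simp only [mpcG2, mpcForm_coeff]
  split_ifs <;> simp

lemma mpcG_map (f : R →+* R') (j : Fin m) : map f (mpcG z j) = mpcG (f ∘ z) j := by
  rw [mpcG, mpcSub_map, mpcA_map, mpcG2_map, mpcG]

lemma mpcXi_map (f : R →+* R') (i : ι) : f (mpcXi z i) = mpcXi (f ∘ z) i := by
  have h := congrFun (congrFun (RingHom.map_adjugate f (mpcA z)) i) s
  rw [RingHom.mapMatrix_apply, RingHom.mapMatrix_apply, mpcA_map, Matrix.map_apply] at h
  exact h

lemma mpcG_eval_xi (j : Fin m) : eval (mpcXi z) (mpcG z j) = 0 := by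
  have h1 : (mpcA z).mulVec (mpcXi z) = Pi.single s (mpcA z).det := by
    have : mpcXi z = (mpcA z).adjugate.mulVec (Pi.single s 1) := by
      ext i; simp [mpcXi]
    rw [this, Matrix.mulVec_mulVec, Matrix.mul_adjugate]
    ext i
    simp [Pi.single_apply, Matrix.one_apply]
  rw [mpcG, mpcSub_eval, h1, eval_eq']
  refine Finset.sum_eq_zero fun μ hμ => ?_
  have hnb : ¬ mpcBad s lev μ := fun hb => (mem_support_iff.mp hμ) (mpcG2_coeff_bad z j μ hb)
  rw [mpcBad] at hnb
  push Not at hnb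
  obtain ⟨b, hb, hb0, -⟩ := hnb
  rw [Finset.prod_eq_zero (Finset.mem_univ b), mul_zero]
  rw [Pi.single_apply, if_neg hb, zero_pow hb0]

/-- The generic forms vanish on the linear space. -/
lemma mpcG_supp (hs : lev s = 0) (j : Fin m) (μ : ι →₀ ℕ) (hμ : ∀ i, lev i = 0 → μ i = 0) :
    coeff μ (mpcG z j) = 0 := by
  have hA : ∀ i, lev i = 0 → ∀ k, lev k ≠ 0 → mpcA z i k = 0 := by
    intro i hi k hk
    have hik : i ≠ k := by rintro rfl; exact hk hi
    have hsk : s ≠ k := by rintro rfl; exact hk hs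
    rw [mpcA, add_mul, one_mul, Matrix.add_apply, Matrix.mul_apply]
    have h1 : mpcH z i k = 0 := by simp [mpcH, hi, hik]
    rw [h1, zero_add]
    refine Finset.sum_eq_zero fun x _ => ?_
    rw [Matrix.vecMulVec_apply, Pi.single_apply]
    by_cases hx : x = s
    · subst hx; simp [mpcH, hs, hsk]
    · simp [hx]
  have key : mpcG z j ∈ Ideal.span ((X : ι → MvPolynomial ι R) '' {i | lev i = 0}) := by
    rw [mpcG, (mpcG2 z j).as_sum, map_sum]
    refine Ideal.sum_mem _ fun ν hν => ?_
    have hnb : ¬ mpcBad s lev ν := fun hb => (mem_support_iff.mp hν) (mpcG2_coeff_bad z j ν hb)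
    have : ∃ i, lev i = 0 ∧ ν i ≠ 0 := by
      rw [mpcBad] at hnb
      push Not at hnb
      obtain ⟨b, hb, hb0, hb1⟩ := hnb
      by_cases h : ν s = 0
      · exact ⟨b, by omega, hb0⟩
      · exact ⟨s, hs, h⟩
    obtain ⟨i, hi, hνi⟩ := this
    have h1 : (monomial ν (coeff ν (mpcG2 z j)) : MvPolynomial ι R) =
        monomial (ν - Finsupp.single i 1) (coeff ν (mpcG2 z j)) * X i := by
      rw [X, monomial_mul, mul_one, tsub_add_cancel_of_le]
      rw [Finsupp.single_le_iff]
      omega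
    rw [h1, map_mul]
    refine Ideal.mul_mem_left _ _ ?_
    simp only [mpcSub, aeval_X]
    refine Ideal.sum_mem _ fun k _ => ?_
    by_cases hk : lev k = 0
    · exact Ideal.mul_mem_left _ _ (Ideal.subset_span ⟨k, hk, rfl⟩)
    · rw [hA i hi k hk]; simp
  rw [mem_ideal_span_X_image] at key
  by_contra h
  obtain ⟨i, hi, h2⟩ := key μ (mem_support_iff.mpr h)
  exact h2 (hμ i hi)

lemma mpcOm_s : mpcOm z s = 0 := by simp [mpcOm]

end generic

section generic

set_option linter.unusedSectionVars false

variable {ι : Type*} [Fintype ι] [DecidableEq ι] {s : ι} {lev : ι → ℕ} {m : ℕ}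

lemma mpc_inv_mem {Ω n : Type*} [Field Ω] [Fintype n] [DecidableEq n] (S : Subfield Ω)
    (M : Matrix n n Ω) (hM : ∀ i j, M i j ∈ S) (hdet : M.det ≠ 0) (i j : n) : M⁻¹ i j ∈ S := by
  refine mpc_solve S M hM hdet (fun i => M⁻¹ i j) ?_ i
  intro a
  have h := congrFun (congrFun (Matrix.mul_nonsing_inv M (isUnit_iff_ne_zero.mpr hdet)) a) j
  rw [Matrix.mul_apply] at h
  rw [h, Matrix.one_apply]
  split_ifs
  · exact S.one_mem
  · exact S.zero_mem

/-- The pivot matrices. -/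
noncomputable def mpcPiv {R : Type*} [CommRing R] (e : MpcE s lev m → ι) (z : MpcJ s lev m → R)
    (i : ℕ) : Matrix {ε : MpcE s lev m // ε.1.2 s = i + 1} {ε : MpcE s lev m // ε.1.2 s = i + 1} R :=
  Matrix.of (fun ε ε' : {ε : MpcE s lev m // ε.1.2 s = i + 1} =>
      coeff (ε.1.1.2 - Finsupp.single s 1 + Finsupp.single (e ε'.1) 1) (mpcG2 z ε.1.1.1))

lemma mpc_gen_all {Ω : Type*} [Field Ω] (S : Subfield Ω)
    [Fintype (MpcE s lev m)] [DecidableEq (MpcE s lev m)] (e : MpcE s lev m → ι)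
    (he : Function.Injective e)
    (hes : ∀ ε, e ε ≠ s) (hel : ∀ ε, lev (e ε) + 1 = ε.1.2 s)
    (z : MpcJ s lev m → Ω)
    (hz1 : ∀ p, z (Sum.inl p) ∈ S)
    (hz2 : ∀ i : {i : ι // i ≠ s}, i.1 ∉ Set.range e → z (Sum.inr (Sum.inl i)) ∈ S)
    (hz3 : ∀ j μ, coeff μ (mpcG z j) ∈ S)
    (hH : (mpcH z).det ≠ 0) (hdet : ∀ i, (mpcPiv e z i).det ≠ 0) :
    ∀ x, z x ∈ S := by
  have hHS : ∀ i k, mpcH z i k ∈ S := by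
    intro i k
    simp only [mpcH, Matrix.of_apply]
    split_ifs
    · exact hz1 _
    · exact S.one_mem
    · exact S.zero_mem
  have hlin : ∀ (M : Matrix ι ι Ω), (∀ i k, M i k ∈ S) → ∀ p : MvPolynomial ι Ω,
      (∀ μ, coeff μ p ∈ S) → ∀ μ, coeff μ (mpcSub M p) ∈ S := by
    intro M hM p hp μ
    refine mpc_coeff_mem S _ ?_ _ hp μ
    intro i
    rw [← mpc_mem_range_map]
    refine Subring.sum_mem _ fun k _ => Subring.mul_mem _ ⟨C ⟨M i k, hM i k⟩, by simp⟩ ⟨X k, by simp⟩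
  have hsh : ∀ j, mpcSub (mpcH z)⁻¹ (mpcG z j) = mpcShear s (-mpcOm z) (mpcG2 z j) := by
    intro j
    rw [mpcG, mpcSub_mpcSub, mpcA, mul_assoc,
      Matrix.mul_nonsing_inv _ (isUnit_iff_ne_zero.mpr hH), mul_one, mpcSub_shear]
  have hF : ∀ j ν, coeff ν (mpcShear s (-mpcOm z) (mpcG2 z j)) ∈ S := by
    intro j
    rw [← hsh]
    exact hlin _ (mpc_inv_mem S _ hHS hH) _ (hz3 j)
  have hω : ∀ a, mpcOm z a ∈ S := by
    refine mpc_gen_pivot S s lev m (mpcG2 z) (mpcG2_coeff_bad z) (mpcOm z) (mpcOm_s z) hF e he hes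
      hel ?_ hdet
    intro a ha
    simp only [mpcOm]
    split_ifs with h
    · exact hz2 ⟨a, h⟩ ha
    · exact S.zero_mem
  have h2 : ∀ j ν, coeff ν (mpcG2 z j) ∈ S := by
    intro j ν
    have : mpcG2 z j = mpcShear s (mpcOm z) (mpcShear s (-mpcOm z) (mpcG2 z j)) := by
      rw [mpcShear_comp s _ _ (mpcOm_s z), neg_add_cancel, mpcShear_zero]
    rw [this, ← mpcSub_shear]
    refine hlin _ ?_ _ (hF j) ν
    intro i k
    simp only [Matrix.add_apply, Matrix.one_apply, Matrix.vecMulVec_apply, Pi.single_apply]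
    refine S.add_mem ?_ (S.mul_mem (hω i) ?_)
    · split_ifs
      · exact S.one_mem
      · exact S.zero_mem
    · split_ifs
      · exact S.one_mem
      · exact S.zero_mem
  rintro (x | x | ⟨⟨j, μ⟩, hx⟩)
  · exact hz1 x
  · have := hω x.1
    simpa [mpcOm, x.2] using this
  · have := h2 j μ
    rwa [mpcG2_coeff z j μ hx] at this

lemma mpcH_det_ne {K Ω : Type*} [Field K] [CommRing Ω] (φ : MvPolynomial (MpcJ s lev m) K →+* Ω)
    (hφ : Function.Injective φ) : (mpcH (φ ∘ X : MpcJ s lev m → Ω)).det ≠ 0 := by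
  rw [← mpcH_map, ← RingHom.mapMatrix_apply, ← RingHom.map_det]
  rw [Ne, map_eq_zero_iff φ hφ]
  intro h
  let z : MpcJ s lev m → K := Sum.elim (fun p => if p.1 = p.2 then 1 else 0) 0
  have h1 := congrArg (eval z) h
  rw [RingHom.map_det, RingHom.mapMatrix_apply, mpcH_map] at h1
  have h2 : mpcH (⇑(eval z) ∘ X : MpcJ s lev m → K) = 1 := by
    ext i k
    simp only [mpcH, Matrix.of_apply, Function.comp, eval_X, z, Matrix.one_apply, Sum.elim_inl,
      Subtype.mk.injEq]
    split_ifs <;> rfl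
  rw [h2] at h1
  simp at h1

lemma mpcPiv_det_ne {K Ω : Type*} [Field K] [CommRing Ω] (φ : MvPolynomial (MpcJ s lev m) K →+* Ω)
    (hφ : Function.Injective φ) [Fintype (MpcE s lev m)] [DecidableEq (MpcE s lev m)]
    (e : MpcE s lev m → ι) (he : Function.Injective e)
    (hes : ∀ ε, e ε ≠ s) (hel : ∀ ε, lev (e ε) + 1 = ε.1.2 s) (i : ℕ) :
    (mpcPiv e (φ ∘ X : MpcJ s lev m → Ω) i).det ≠ 0 := by
  classical
  rw [show mpcPiv e (φ ∘ X : MpcJ s lev m → Ω) i = (mpcPiv e (X : MpcJ s lev m → MvPolynomial _ K) i).map φ by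
    ext ε ε'
    simp only [mpcPiv, Matrix.map_apply, Matrix.of_apply]
    rw [← mpcG2_map, coeff_map]]
  rw [← RingHom.mapMatrix_apply, ← RingHom.map_det]
  rw [Ne, map_eq_zero_iff φ hφ]
  intro h
  let z : MpcJ s lev m → K := Sum.elim 0 (Sum.elim 0 (fun x =>
    if ∃ ε : MpcE s lev m, ε.1.2 s = i + 1 ∧ x.1.1 = ε.1.1 ∧
      x.1.2 = ε.1.2 - Finsupp.single s 1 + Finsupp.single (e ε) 1 then 1 else 0))
  have h1 := congrArg (eval z) h
  rw [RingHom.map_det, RingHom.mapMatrix_apply] at h1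
  have h2 : (mpcPiv e (X : MpcJ s lev m → MvPolynomial _ K) i).map (eval z) = 1 := by
    ext ε ε'
    have hl' := hel ε'.1
    have hε := ε.2
    have hε' := ε'.2
    have hcond : ∑ a, (ε.1.1.2 - Finsupp.single s 1 + Finsupp.single (e ε'.1) 1 : ι →₀ ℕ) a
        = (ε.1.1.1 : ℕ) + 1 ∧
        ¬ mpcBad s lev (ε.1.1.2 - Finsupp.single s 1 + Finsupp.single (e ε'.1) 1) := by
      constructor
      · have h3 : ε.1.1.2 - Finsupp.single s 1 + Finsupp.single s 1 = ε.1.1.2 := by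
          rw [tsub_add_cancel_of_le]
          rw [Finsupp.single_le_iff, ε.2]; omega
        have h4 := ε.1.2.1
        rw [← h3] at h4
        rw [← h4]
        simp only [Finsupp.add_apply, Finset.sum_add_distrib]
        simp [Finsupp.single_apply]
      · intro hb
        have := hb (e ε'.1) (hes _) (by simp)
        simp [Finsupp.single_apply, hes] at this
        omega
    simp only [mpcPiv, Matrix.map_apply, Matrix.of_apply]
    rw [mpcG2_coeff _ _ _ hcond, eval_X]
    simp only [z, Sum.elim_inr]
    rw [Matrix.one_apply]
    by_cases hee : ε = ε'
    · subst hee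
      rw [if_pos rfl, if_pos ⟨ε.1, ε.2, rfl, rfl⟩]
    · rw [if_neg hee, if_neg]
      rintro ⟨ε'', h3, h4, h5⟩
      have hz0 : ∀ (δ : MpcE s lev m), δ.1.2 s = i + 1 → ∀ a, a ≠ s → lev a = i →
          (δ.1.2 - Finsupp.single s 1 : ι →₀ ℕ) a = 0 := by
        intro δ hδ a ha hla
        by_contra hne
        have := δ.2.2.1 a ha (by
          intro h0; apply hne; simp [h0])
        omega
      have h6 : e ε'.1 = e ε'' := by
        by_contra hne
        have h7 := congrArg (fun f : ι →₀ ℕ => f (e ε'.1)) h5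
        have h8 := hz0 ε'' h3 (e ε'.1) (hes _) (by omega)
        simp only [Finsupp.add_apply, h8] at h7
        simp [Finsupp.single_apply, Ne.symm hne] at h7
      have h9 := he h6
      rw [h6] at h5
      have h10 := add_right_cancel h5
      have h11 : ε.1.1.2 = ε''.1.2 := by
        have := congrArg (fun f => f + Finsupp.single s 1) h10
        rwa [tsub_add_cancel_of_le, tsub_add_cancel_of_le] at this
        · rw [Finsupp.single_le_iff, h3]; omega
        · rw [Finsupp.single_le_iff, ε.2]; omega
      apply hee
      apply Subtype.ext
      rw [h9]
      exact Subtype.ext (Prod.ext h4 h11)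
  rw [h2] at h1
  simp at h1

lemma mpc_finite_aux (P : Fin m × (ι →₀ ℕ) → Prop)
    (hP : ∀ x, P x → ∑ i, x.2 i = (x.1 : ℕ) + 1) : Finite {x // P x} := by
  let F : Finset (ι →₀ ℕ) := (Finset.range (m + 1)).biUnion
      (fun n => Finset.finsuppAntidiag Finset.univ n)
  have hF : Finite {μ // μ ∈ F} := Finite.of_fintype F
  have hF2 : Finite (Fin m × {μ // μ ∈ F}) := inferInstance
  refine Finite.of_injective (β := Fin m × {μ // μ ∈ F}) (fun x => ⟨x.1.1, x.1.2, ?_⟩) ?_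
  · have h1 := hP _ x.2
    have h2 := x.1.1.2
    exact Finset.mem_biUnion.mpr ⟨_, Finset.mem_range.mpr (by omega : (x.1.1 : ℕ) + 1 < m + 1), by
      simpa using h1⟩
  · rintro ⟨⟨j, μ⟩, h⟩ ⟨⟨j', μ'⟩, h'⟩ hxy
    simp at hxy
    simp [hxy]

instance mpcE_finite : Finite (MpcE s lev m) := mpc_finite_aux _ fun _ h => h.1

instance mpcC_finite : Finite (MpcC s lev m) := mpc_finite_aux _ fun _ h => h.1

end generic

section generic

set_option linter.unusedSectionVars false

variable {ι : Type*} [Fintype ι] [DecidableEq ι] {s : ι} {lev : ι → ℕ} {m : ℕ}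

/-- Parameters which stay free. -/
abbrev MpcT (e : MpcE s lev m → ι) : Type _ :=
  (MpcLt lev × MpcLt lev) ⊕ {i : ι // i ≠ s ∧ i ∉ Set.range e}

/-- Index set of the coefficients of the given forms. -/
abbrev MpcB (Y : ι → Prop) (m : ℕ) : Type _ :=
  Σ j : Fin m, {μ : ι →₀ ℕ // (∑ i, μ i) = (j : ℕ) + 1 ∧ ∃ i, Y i ∧ μ i ≠ 0}

noncomputable def mpcx {R : Type*} [CommRing R] (Y : ι → Prop) (e : MpcE s lev m → ι)
    (z : MpcJ s lev m → R) : MpcT e ⊕ MpcB Y m → R :=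
  Sum.elim (Sum.elim (fun p => z (Sum.inl p)) (fun i => z (Sum.inr (Sum.inl ⟨i.1, i.2.1⟩))))
    (fun p => coeff p.2.1 (mpcG z p.1))

lemma mpcB_finite (Y : ι → Prop) : Finite (MpcB Y m) := by
  have := mpc_finite_aux (m := m) (fun x : Fin m × (ι →₀ ℕ) => ∑ i, x.2 i = (x.1 : ℕ) + 1) fun _ h => h
  refine Finite.of_injective (β := {x : Fin m × (ι →₀ ℕ) // ∑ i, x.2 i = (x.1 : ℕ) + 1})
    (fun x => ⟨(x.1, x.2.1), x.2.2.1⟩) ?_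
  rintro ⟨j, μ, h⟩ ⟨j', μ', h'⟩ hxy
  simp at hxy
  obtain ⟨rfl, rfl⟩ := hxy
  rfl

lemma mpc_card (Y : ι → Prop) (hY : ∀ i, Y i ↔ lev i = 0) (hs : lev s = 0)
    (e : MpcE s lev m → ι) (he : Function.Injective e) (hes : ∀ ε, e ε ≠ s) :
    ∃ f : MpcT e ⊕ MpcB Y m → MpcJ s lev m, Function.Injective f := by
  classical
  have hE : ∀ p : MpcB Y m, mpcBad s lev p.2.1 → p.2.1 s ≠ 0 := by
    intro p hb h0
    obtain ⟨i, hi, hi2⟩ := p.2.2.2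
    by_cases his : i = s
    · subst his; exact hi2 h0
    · have := hb i his hi2
      have h3 := (hY i).mp hi
      omega
  let g : MpcB Y m → MpcJ s lev m := fun p =>
    if h : mpcBad s lev p.2.1 then
      Sum.inr (Sum.inl ⟨e ⟨(p.1, p.2.1), p.2.2.1, h, hE p h⟩, hes _⟩)
    else Sum.inr (Sum.inr ⟨(p.1, p.2.1), p.2.2.1, h⟩)
  have hext : ∀ p p' : MpcB Y m, p.1 = p'.1 → p.2.1 = p'.2.1 → p = p' := by
    rintro ⟨j, μ, h⟩ ⟨j', μ', h'⟩ h1 h2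
    simp at h1 h2
    subst h1; subst h2; rfl
  refine ⟨Sum.elim (Sum.elim (fun p => Sum.inl p) (fun i => Sum.inr (Sum.inl ⟨i.1, i.2.1⟩))) g, ?_⟩
  refine Function.Injective.sumElim (Function.Injective.sumElim ?_ ?_ ?_) ?_ ?_
  · exact Sum.inl_injective
  · intro a b hab
    simp at hab
    exact Subtype.ext hab
  · intro a b; simp
  · intro p p' h
    simp only [g] at h
    split_ifs at h with h1 h2 h2
    · simp only [Sum.inr.injEq, Sum.inl.injEq, Subtype.mk.injEq] at h
      have := he h
      simp at this
      exact hext _ _ this.1 this.2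
    · simp at h
    · simp at h
    · simp only [Sum.inr.injEq, Subtype.mk.injEq, Prod.mk.injEq] at h
      exact hext _ _ h.1 h.2
  · rintro (a | a) p h
    · simp only [g] at h
      split_ifs at h <;> simp at h
    · simp only [g] at h
      split_ifs at h
      · simp only [Sum.elim_inl, Sum.elim_inr, Sum.inr.injEq, Sum.inl.injEq, Subtype.mk.injEq] at h
        exact a.2.2 ⟨_, h.symm⟩
      · simp at h

lemma mpcx_basis {K : Type*} [Field K] (Y : ι → Prop) (hY : ∀ i, Y i ↔ lev i = 0) (hs : lev s = 0)
    (e : MpcE s lev m → ι) (he : Function.Injective e) (hes : ∀ ε, e ε ≠ s)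
    (hel : ∀ ε, lev (e ε) + 1 = ε.1.2 s) :
    IntermediateField.adjoin K (Set.range (mpcx Y e
      (algebraMap (MvPolynomial (MpcJ s lev m) K) (FractionRing (MvPolynomial (MpcJ s lev m) K)) ∘ X))) = ⊤ ∧
    AlgebraicIndependent K (mpcx Y e
      (algebraMap (MvPolynomial (MpcJ s lev m) K) (FractionRing (MvPolynomial (MpcJ s lev m) K)) ∘ X)) := by
  classical
  have := Fintype.ofFinite (MpcE s lev m)
  set Ω := FractionRing (MvPolynomial (MpcJ s lev m) K)
  set φ := algebraMap (MvPolynomial (MpcJ s lev m) K) Ω with hφ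
  have hinj : Function.Injective φ := IsFractionRing.injective _ _
  set z : MpcJ s lev m → Ω := φ ∘ X with hz
  set x := mpcx Y e z with hx
  set S := IntermediateField.adjoin K (Set.range x) with hS
  have hxS : ∀ j, x j ∈ S := fun j => IntermediateField.subset_adjoin _ _ ⟨j, rfl⟩
  have hzS : ∀ j, z j ∈ S.toSubfield := by
    refine mpc_gen_all S.toSubfield e he hes hel z ?_ ?_ ?_ (mpcH_det_ne φ hinj)
      (mpcPiv_det_ne φ hinj e he hes hel)
    · intro p; exact hxS (Sum.inl (Sum.inl p))
    · intro i hi; exact hxS (Sum.inl (Sum.inr ⟨i.1, i.2, hi⟩))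
    · intro j μ
      by_cases h0 : coeff μ (mpcG z j) = 0
      · rw [h0]; exact S.zero_mem
      · have h1 := mpc_homog_sum (mpcG_homog z j) h0
        have h2 : ∃ i, Y i ∧ μ i ≠ 0 := by
          by_contra hcon
          push Not at hcon
          exact h0 (mpcG_supp z hs j μ fun i hi => hcon i ((hY i).mpr hi))
        exact hxS (Sum.inr ⟨j, μ, h1, h2⟩)
  have htop : S = ⊤ := by
    rw [eq_top_iff]
    intro w _
    have hP : ∀ p : MvPolynomial (MpcJ s lev m) K, φ p ∈ S := by
      intro p
      induction p using MvPolynomial.induction_on with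
      | C a => exact S.algebraMap_mem a
      | add p q hp hq => rw [map_add]; exact S.add_mem hp hq
      | mul_X p i hp => rw [map_mul]; exact S.mul_mem hp (hzS i)
    obtain ⟨a, b, -, rfl⟩ := IsFractionRing.div_surjective (A := MvPolynomial (MpcJ s lev m) K) w
    exact S.div_mem (hP a) (hP b)
  refine ⟨htop, ?_⟩
  have hfin := mpcB_finite (m := m) Y
  have halg : Algebra.IsAlgebraic (Algebra.adjoin K (Set.range x)) Ω := by
    refine ⟨fun w => ?_⟩
    have hw : w ∈ S := by rw [htop]; trivial
    obtain ⟨a, ha, b, hb, rfl⟩ := IntermediateField.mem_adjoin_iff_div.mp hw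
    rw [div_eq_mul_inv]
    exact (isAlgebraic_algebraMap (⟨a, ha⟩ : Algebra.adjoin K (Set.range x))).mul
      (isAlgebraic_algebraMap (⟨b, hb⟩ : Algebra.adjoin K (Set.range x))).inv
  have hzi : AlgebraicIndependent K z := by
    have := (MvPolynomial.algebraicIndependent_X (MpcJ s lev m) K).map' (f := IsScalarTower.toAlgHom K (MvPolynomial (MpcJ s lev m) K) Ω) hinj
    exact this
  obtain ⟨f, hf⟩ := mpc_card Y hY hs e he hes
  refine (Algebra.IsAlgebraic.isTranscendenceBasis_of_lift_le_trdeg_of_finite K x ?_).1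
  refine le_trans ?_ hzi.lift_cardinalMk_le_trdeg
  exact Cardinal.lift_le.mpr (Cardinal.mk_le_of_injective hf)

end generic

section special

set_option linter.unusedSectionVars false

variable {ι : Type*} [Fintype ι] [DecidableEq ι] {s : ι} {lev : ι → ℕ} {m : ℕ}

lemma mpc_coeff_zero_of_eval {k : Type*} [Field k] [Infinite k] (U : ι → Prop)
    (p : MvPolynomial ι k) (hp : ∀ x : ι → k, (∀ i, ¬ U i → x i = 0) → eval x p = 0)
    (μ : ι →₀ ℕ) (hμ : ∀ i, μ i ≠ 0 → U i) : coeff μ p = 0 := by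
  classical
  let q : MvPolynomial ι k := ∑ ν ∈ p.support.filter (fun ν => ∀ i, ν i ≠ 0 → U i),
    monomial ν (coeff ν p)
  have hq : q = 0 := by
    apply MvPolynomial.funext
    intro x
    rw [map_zero, ← hp (fun i => if U i then x i else 0) (fun i hi => by simp [hi])]
    rw [eval_eq' (fun i => if U i then x i else 0) p]
    simp only [q]
    rw [map_sum, Finset.sum_filter]
    refine Finset.sum_congr rfl fun ν _ => ?_
    split_ifs with h
    · rw [eval_monomial, Finsupp.prod_fintype _ _ (by simp)]
      congr 1
      refine Finset.prod_congr rfl fun i _ => ?_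
      by_cases hi : U i
      · simp [hi]
      · have : ν i = 0 := by
          by_contra h0; exact hi (h i h0)
        simp [this]
    · push Not at h
      obtain ⟨i, hi, hU⟩ := h
      rw [Finset.prod_eq_zero (Finset.mem_univ i), mul_zero]
      simp [hU, hi]
  have h1 : coeff μ q = coeff μ p := by
    simp only [q, coeff_sum, coeff_monomial]
    rw [Finset.sum_ite_eq']
    split_ifs with h
    · rfl
    · by_contra h2
      apply h
      rw [Finset.mem_filter, mem_support_iff]
      exact ⟨fun h3 => h2 h3.symm, hμ⟩
  rw [← h1, hq, coeff_zero]

/-- Extend a square matrix on the linear space by the identity. -/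
noncomputable def mpcBlk {R : Type*} [CommRing R] (M : Matrix (MpcLt lev) (MpcLt lev) R) :
    Matrix ι ι R :=
  Matrix.of fun i k => if h : lev i ≠ 0 ∧ lev k ≠ 0 then M ⟨i, h.1⟩ ⟨k, h.2⟩
    else if i = k then 1 else 0

lemma mpcBlk_mulVec {R : Type*} [CommRing R] (M : Matrix (MpcLt lev) (MpcLt lev) R) (x : ι → R)
    (i : ι) : (mpcBlk M).mulVec x i =
      if h : lev i ≠ 0 then ∑ k : MpcLt lev, M ⟨i, h⟩ k * x k else x i := by
  rw [Matrix.mulVec, dotProduct, ← Fintype.sum_subtype_add_sum_subtype (fun k => lev k ≠ 0)]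
  split_ifs with h
  · have h2 : ∑ k : {k // ¬ (lev k ≠ 0)}, mpcBlk M i k * x k = 0 := by
      refine Finset.sum_eq_zero fun k _ => ?_
      have hk : lev k.1 = 0 := not_not.mp k.2
      have hik : i ≠ k.1 := by rintro rfl; exact h hk
      simp [mpcBlk, hk, hik]
    rw [h2, add_zero]
    refine Finset.sum_congr rfl fun k _ => ?_
    have hk := k.2
    simp [mpcBlk, hk, h]
  · have hi : lev i = 0 := not_not.mp h
    have h2 : ∑ k : MpcLt lev, mpcBlk M i k * x k = 0 := by
      refine Finset.sum_eq_zero fun k _ => ?_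
      have hk : lev k.1 ≠ 0 := k.2
      have hik : i ≠ k.1 := by rintro rfl; exact hk hi
      simp [mpcBlk, hi, hik]
    rw [h2, zero_add, Finset.sum_eq_single (⟨i, h⟩ : {k // ¬ (lev k ≠ 0)})]
    · simp [mpcBlk, hi]
    · intro k _ hk
      have hik : i ≠ k.1 := by rintro rfl; exact hk rfl
      simp [mpcBlk, hi, hik]
    · simp

lemma mpcBlk_mul {R : Type*} [CommRing R] (M N : Matrix (MpcLt lev) (MpcLt lev) R)
    (h : M * N = 1) : mpcBlk M * mpcBlk N = (1 : Matrix ι ι R) := by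
  ext i k
  have h1 : (mpcBlk M * mpcBlk N) i k = (mpcBlk M).mulVec (fun j => mpcBlk N j k) i := rfl
  rw [h1, mpcBlk_mulVec, Matrix.one_apply]
  by_cases hi : lev i ≠ 0
  · rw [dif_pos hi]
    by_cases hk : lev k ≠ 0
    · have h2 := congrFun (congrFun h ⟨i, hi⟩) ⟨k, hk⟩
      rw [Matrix.mul_apply, Matrix.one_apply] at h2
      simp only [Subtype.mk.injEq] at h2
      rw [← h2]
      refine Finset.sum_congr rfl fun j _ => ?_
      have hj := j.2
      simp [mpcBlk, hj, hk]
    · have hk' : lev k = 0 := not_not.mp hk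
      have hik : i ≠ k := by rintro rfl; exact hi hk'
      rw [if_neg hik]
      refine Finset.sum_eq_zero fun j _ => ?_
      have hj : lev j.1 ≠ 0 := j.2
      have hjk : j.1 ≠ k := by rintro rfl; exact hj hk'
      simp [mpcBlk, hk', hjk]
  · rw [dif_neg hi]
    have hi' : lev i = 0 := not_not.mp hi
    simp [mpcBlk, hi']

/-- Extending a linearly independent family to a basis with prescribed indices. -/
lemma mpc_basis_extend {k V n : Type*} [Field k] [AddCommGroup V] [Module k V] [Module.Finite k V]
    [Fintype n] (hn : Module.finrank k V = Fintype.card n) (p : n → Prop)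
    (w : {a // p a} → V) (hw : LinearIndependent k w) :
    ∃ b : Module.Basis n k V, ∀ a : {a // p a}, b a.1 = w a := by
  classical
  let b0 := Module.Basis.sumExtend hw
  have hfin := Module.Finite.finite_basis b0
  have hfin2 : Finite (Module.Basis.sumExtendIndex hw) := Finite.of_injective _ (Sum.inr_injective (α := {a // p a}))
  have := Fintype.ofFinite (Module.Basis.sumExtendIndex hw)
  have hc : Fintype.card (Module.Basis.sumExtendIndex hw) = Fintype.card {a // ¬ p a} := by
    have h1 := Module.finrank_eq_card_basis b0
    rw [hn, Fintype.card_sum] at h1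
    have h2 := Fintype.card_subtype_compl p
    have h3 := Fintype.card_subtype_le p
    omega
  let θ := Fintype.equivOfCardEq hc
  let τ := (Equiv.sumCongr (Equiv.refl {a // p a}) θ).trans (Equiv.sumCompl p)
  refine ⟨b0.reindex τ, fun a => ?_⟩
  rw [Module.Basis.reindex_apply]
  have : τ.symm a.1 = Sum.inl a := by
    rw [Equiv.symm_apply_eq]; simp [τ]
  rw [this]
  simp only [b0, Module.Basis.sumExtend, Module.Basis.reindex_apply, Module.Basis.coe_extend]
  have h0 : Set.range w ⊆ hw.linearIndepOn_id.extend (Set.subset_univ (Set.range w)) :=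
    hw.linearIndepOn_id.subset_extend _
  have h1 := Equiv.Set.sumDiffSubset_apply_inl h0 (Equiv.ofInjective w hw.injective a)
  exact (congrArg Subtype.val h1)

end special

section special2

set_option linter.unusedSectionVars false

variable {ι : Type*} [Fintype ι] [DecidableEq ι] {s : ι} {lev : ι → ℕ} {m : ℕ}

/-- Extension by zero from the linear space. -/
def mpcExt (k : Type*) [Field k] (lev : ι → ℕ) : (MpcLt lev → k) →ₗ[k] (ι → k) where
  toFun x i := if h : lev i ≠ 0 then x ⟨i, h⟩ else 0
  map_add' x y := by ext i; simp only [Pi.add_apply]; split_ifs <;> simp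
  map_smul' c x := by ext i; simp only [Pi.smul_apply, RingHom.id_apply]; split_ifs <;> simp

lemma mpcExt_inj (k : Type*) [Field k] : Function.Injective (mpcExt k lev) := by
  intro x y h
  ext i
  have := congrFun h i.1
  have hi : lev i.1 ≠ 0 := i.2
  simpa [mpcExt, hi] using this

/-- Existence of an adapted basis. -/
lemma mpc_adapted {k : Type*} [Field k] [IsAlgClosed k]
    (G : Fin m → MvPolynomial ι k) (hG : ∀ j, (G j).IsHomogeneous ((j : ℕ) + 1))
    (ξ : ι → k) (hξ : ∀ j, eval ξ (G j) = 0)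
    (hT : Fintype.card {i : ι // 2 ≤ lev i} + m * (m + 1) ^ (Fintype.card {i : ι // 2 ≤ lev i})
      < Fintype.card (MpcLt lev)) :
    ∃ B h : Matrix (MpcLt lev) (MpcLt lev) k, B * h = 1 ∧ h * B = 1 ∧
      ∀ x : MpcLt lev → k, (∀ a, ¬ (2 ≤ lev a.1) → x a = 0) → ∀ t : k, ∀ j,
        eval (t • ξ + mpcExt k lev (B.mulVec x)) (G j) = 0 := by
  obtain ⟨v, hv1, hv2, hv3⟩ := mpc_subspace G hG (LinearMap.range (mpcExt k lev)) ξ hξ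
    (Fintype.card {i : ι // 2 ≤ lev i})
    (by rw [LinearMap.finrank_range_of_inj (mpcExt_inj k), Module.finrank_fintype_fun_eq_card]; exact hT)
    _ le_rfl
  choose w hw using hv2
  have hwi : LinearIndependent k w := by
    apply LinearIndependent.of_comp (mpcExt k lev)
    have : (mpcExt k lev) ∘ w = v := funext hw
    rwa [this]
  let σ : {a : MpcLt lev // 2 ≤ lev a.1} ≃ Fin (Fintype.card {i : ι // 2 ≤ lev i}) :=
    (Equiv.mk (fun a => ⟨a.1.1, a.2⟩) (fun i => ⟨⟨i.1, by have := i.2; omega⟩, i.2⟩)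
      (fun _ => rfl) (fun _ => rfl) : {a : MpcLt lev // 2 ≤ lev a.1} ≃ {i : ι // 2 ≤ lev i}).trans
      (Fintype.equivFin _)
  obtain ⟨b, hb⟩ := mpc_basis_extend (k := k) (V := MpcLt lev → k) (n := MpcLt lev)
    (Module.finrank_fintype_fun_eq_card k) (fun a => 2 ≤ lev a.1) (w ∘ σ) (hwi.comp _ σ.injective)
  refine ⟨(Pi.basisFun k (MpcLt lev)).toMatrix b, b.toMatrix (Pi.basisFun k (MpcLt lev)),
    Module.Basis.toMatrix_mul_toMatrix_flip _ _, Module.Basis.toMatrix_mul_toMatrix_flip _ _, ?_⟩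
  intro x hx t j
  apply hv3
  refine Submodule.add_mem_sup (Submodule.smul_mem _ _ (Submodule.mem_span_singleton_self _)) ?_
  have h1 : ((Pi.basisFun k (MpcLt lev)).toMatrix b).mulVec x = ∑ a, x a • b a := by
    ext i
    simp [Matrix.mulVec, dotProduct, Module.Basis.toMatrix_apply, mul_comm]
  rw [h1, map_sum]
  refine Submodule.sum_mem _ fun a _ => ?_
  rw [map_smul]
  by_cases ha : 2 ≤ lev a.1
  · apply Submodule.smul_mem
    rw [hb ⟨a, ha⟩]
    simp only [Function.comp]
    rw [hw]
    exact Submodule.subset_span ⟨_, rfl⟩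
  · rw [hx a ha, zero_smul]; exact zero_mem _

lemma mpc_special {k : Type*} [Field k] [IsAlgClosed k] (hs : lev s = 0)
    (G : Fin m → MvPolynomial ι k) (hG : ∀ j, (G j).IsHomogeneous ((j : ℕ) + 1))
    (hGs : ∀ j, ∀ μ ∈ (G j).support, ∃ i, lev i = 0 ∧ μ i ≠ 0)
    (ξ : ι → k) (hξs : ξ s = 1) (hξ : ∀ j, eval ξ (G j) = 0)
    (hT : Fintype.card {i : ι // 2 ≤ lev i} + m * (m + 1) ^ (Fintype.card {i : ι // 2 ≤ lev i})
      < Fintype.card (MpcLt lev)) :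
    ∃ z : MpcJ s lev m → k, (∀ j, mpcG z j = G j) ∧ ∃ c : k, c ≠ 0 ∧ ∀ i, mpcXi z i = c * ξ i := by
  obtain ⟨B, h, hBh, hhB, hsub⟩ := mpc_adapted (lev := lev) G hG ξ hξ hT
  let ω : ι → k := fun i => if i = s then 0 else (mpcBlk h).mulVec ξ i
  let Ai : Matrix ι ι k := mpcBlk B * (1 + Matrix.vecMulVec ω (Pi.single s 1))
  let z : MpcJ s lev m → k := Sum.elim (fun p => h p.1 p.2)
    (Sum.elim (fun i => ω i.1) (fun x => coeff x.1.2 (mpcSub Ai (G x.1.1))))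
  have hH : mpcH z = mpcBlk h := by
    ext i k; simp [mpcH, mpcBlk, z]
  have hO : mpcOm z = ω := by
    ext i
    by_cases hi : i = s
    · subst hi; simp [mpcOm, ω]
    · simp [mpcOm, z, hi]
  have hωs : ω s = 0 := by simp [ω]
  have hA : mpcA z = (1 + Matrix.vecMulVec (-ω) (Pi.single s 1)) * mpcBlk h := by
    rw [mpcA, hO, hH]
  have hAiA : Ai * mpcA z = 1 := by
    have h1 : (1 + Matrix.vecMulVec ω (Pi.single s 1)) * (1 + Matrix.vecMulVec (-ω) (Pi.single s 1))
        = (1 : Matrix ι ι k) := by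
      have h2 : Matrix.vecMulVec ω (Pi.single s 1) * Matrix.vecMulVec (-ω) (Pi.single s 1) = (0 : Matrix ι ι k) := by
        rw [Matrix.vecMulVec_mul_vecMulVec]
        simp [hωs]
      rw [add_mul, mul_add, mul_add, h2, Matrix.neg_vecMulVec]
      simp
    rw [hA, Matrix.mul_assoc, ← Matrix.mul_assoc _ _ (mpcBlk h), h1, Matrix.one_mul,
      mpcBlk_mul _ _ hBh]
  have hAAi : mpcA z * Ai = 1 := mul_eq_one_comm.mp hAiA
  have hBξ : (mpcBlk B).mulVec ((mpcBlk h).mulVec ξ) = ξ := by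
    rw [Matrix.mulVec_mulVec, mpcBlk_mul _ _ hBh, Matrix.one_mulVec]
  have hhs : (mpcBlk h).mulVec ξ s = 1 := by
    rw [mpcBlk_mulVec, dif_neg (by simpa using hs), hξs]
  have hωe : ω + Pi.single s 1 = (mpcBlk h).mulVec ξ := by
    ext i
    by_cases hi : i = s
    · subst hi; simp [ω, hhs]
    · simp [ω, hi]
  have hAix : ∀ x : ι → k, Ai.mulVec x = x s • ξ + (mpcBlk B).mulVec (Function.update x s 0) := by
    intro x
    have h3 : (1 + Matrix.vecMulVec ω (Pi.single s 1)).mulVec x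
        = x s • (mpcBlk h).mulVec ξ + Function.update x s 0 := by
      rw [Matrix.add_mulVec, Matrix.one_mulVec, ← hωe]
      ext i
      by_cases hi : i = s
      · subst hi; simp [Matrix.vecMulVec, Matrix.mulVec, dotProduct, Pi.single_apply, hωs]
      · simp [Matrix.vecMulVec, Matrix.mulVec, dotProduct, Pi.single_apply, hi]; ring
    simp only [Ai]
    rw [← Matrix.mulVec_mulVec, h3, Matrix.mulVec_add, Matrix.mulVec_smul, hBξ]
  have hblk : ∀ x : ι → k, (∀ i, lev i = 0 → x i = 0) →
      (mpcBlk B).mulVec x = mpcExt k lev (B.mulVec (fun a => x a.1)) := by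
    intro x hx
    ext i
    rw [mpcBlk_mulVec]
    simp only [mpcExt, LinearMap.coe_mk, AddHom.coe_mk]
    split_ifs with hi
    · rfl
    · exact hx i (not_not.mp hi)
  have hbad : ∀ j μ, mpcBad s lev μ → coeff μ (mpcSub Ai (G j)) = 0 := by
    intro j μ hμ
    by_cases hμs : μ s = 0
    · apply mpc_coeff_zero_of_eval (fun i => lev i ≠ 0)
      · intro x hx
        have hx' : ∀ i, lev i = 0 → x i = 0 := fun i hi => hx i (not_not.mpr hi)
        rw [mpcSub_eval, hAix, hx' s hs, zero_smul, zero_add, hblk _ (by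
          intro i hi
          by_cases his : i = s
          · subst his; simp
          · simp [his, hx' i hi])]
        rw [eval_eq']
        refine Finset.sum_eq_zero fun ν hν => ?_
        obtain ⟨i, hi, hi2⟩ := hGs j ν hν
        rw [Finset.prod_eq_zero (Finset.mem_univ i), mul_zero]
        simp [mpcExt, hi, hi2]
      · intro i hi
        have hne : i ≠ s := by rintro rfl; exact hi hμs
        have := hμ i hne hi
        omega
    · apply mpc_coeff_zero_of_eval (fun i => i = s ∨ 2 ≤ lev i)
      · intro x hx
        rw [mpcSub_eval, hAix, hblk]
        · apply hsub
          intro a ha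
          have hne : a.1 ≠ s := by intro h; exact a.2 (h ▸ hs)
          simp only [Function.update_apply, if_neg hne]
          apply hx; tauto
        · intro i hi
          by_cases his : i = s
          · subst his; simp
          · simp only [Function.update_apply, if_neg his]
            apply hx
            rintro (h | h)
            · exact his h
            · omega
      · intro i hi
        by_cases his : i = s
        · exact Or.inl his
        · right
          have := hμ i his hi
          omega
  have hG2 : ∀ j, mpcG2 z j = mpcSub Ai (G j) := by
    intro j
    ext μ
    by_cases hμ : mpcBad s lev μ
    · rw [mpcG2_coeff_bad _ _ _ hμ, hbad _ _ hμ]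
    · by_cases hd : ∑ i, μ i = (j : ℕ) + 1
      · rw [mpcG2_coeff z j μ ⟨hd, hμ⟩]; rfl
      · have e1 : coeff μ (mpcG2 z j) = 0 := by
          by_contra hc; exact hd (mpc_homog_sum (mpcG2_homog z j) hc)
        have e2 : coeff μ (mpcSub Ai (G j)) = 0 := by
          by_contra hc; exact hd (mpc_homog_sum (mpcSub_homog _ _ (hG j)) hc)
        rw [e1, e2]
  refine ⟨z, fun j => ?_, (mpcA z).det, ?_, fun i => ?_⟩
  · rw [mpcG, hG2, mpcSub_mpcSub, hAiA, mpcSub_one]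
  · intro h0
    have := congrArg Matrix.det hAAi
    rw [Matrix.det_mul, h0, zero_mul, Matrix.det_one] at this
    exact zero_ne_one this
  · have h4 : (mpcA z).adjugate = (mpcA z).det • Ai := by
      calc (mpcA z).adjugate = (mpcA z).adjugate * (mpcA z * Ai) := by rw [hAAi, mul_one]
        _ = _ := by rw [← mul_assoc, Matrix.adjugate_mul, smul_mul_assoc, one_mul]
    have h5 : Ai.mulVec (Pi.single s 1) = ξ := by
      rw [hAix]
      have : Function.update (Pi.single s 1 : ι → k) s 0 = 0 := by
        ext i
        by_cases hi : i = s
        · subst hi; simp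
        · simp [hi]
      rw [this]; simp
    have h6 : Ai i s = ξ i := by
      rw [← congrFun h5 i]; simp
    rw [mpcXi, h4, Matrix.smul_apply, h6, smul_eq_mul]

end special2

section assembly


lemma mpc_clear {K K1 : Type u} [Field K] [Field K1] [Algebra K K1] {B : Type*} (c : B → K1)
    (hc : IntermediateField.adjoin K (Set.range c) = ⊤) {r : ℕ} (f : MvPolynomial (Fin r) K1) :
    ∃ (H : MvPolynomial (B ⊕ Fin (r + 1)) K) (D : ℕ) (d0 : K1), d0 ≠ 0 ∧
      ∀ (R : Type u) [Field R] [Algebra K R] [Algebra K1 R] [IsScalarTower K K1 R]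
        (w : Fin (r + 1) → R), w 0 ≠ 0 →
        aeval (Sum.elim (algebraMap K1 R ∘ c) w) H =
          algebraMap K1 R d0 * w 0 ^ D * aeval (fun i : Fin r => w i.succ / w 0) f := by
  induction f using MvPolynomial.induction_on with
  | C a =>
    have ha : a ∈ IntermediateField.adjoin K (Set.range c) := by rw [hc]; trivial
    rw [IntermediateField.mem_adjoin_range_iff] at ha
    obtain ⟨p, t, hpt⟩ := ha
    by_cases ht : aeval c t = 0
    · refine ⟨0, 0, 1, one_ne_zero, ?_⟩
      intro R _ _ _ _ w hw
      rw [ht, div_zero] at hpt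
      simp [hpt]
    · refine ⟨rename Sum.inl p, 0, aeval c t, ht, ?_⟩
      intro R _ _ _ _ w hw
      rw [aeval_rename, Sum.elim_comp_inl, pow_zero, mul_one, aeval_C, ← map_mul, hpt,
        mul_div_cancel₀ _ ht, aeval_algebraMap_apply]
  | add f g hf hg =>
    obtain ⟨H1, D1, d1, h1, e1⟩ := hf
    obtain ⟨H2, D2, d2, h2, e2⟩ := hg
    have hd1 : d1 ∈ IntermediateField.adjoin K (Set.range c) := by rw [hc]; trivial
    have hd2 : d2 ∈ IntermediateField.adjoin K (Set.range c) := by rw [hc]; trivial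
    rw [IntermediateField.mem_adjoin_range_iff] at hd1 hd2
    obtain ⟨p1, t1, hp1⟩ := hd1
    obtain ⟨p2, t2, hp2⟩ := hd2
    have n1 : aeval c t1 ≠ 0 := by intro h; rw [h, div_zero] at hp1; exact h1 hp1
    have n2 : aeval c t2 ≠ 0 := by intro h; rw [h, div_zero] at hp2; exact h2 hp2
    have k1 : aeval c p1 = d1 * aeval c t1 := by rw [hp1]; field_simp
    have k2 : aeval c p2 = d2 * aeval c t2 := by rw [hp2]; field_simp
    refine ⟨H1 * X (Sum.inr 0) ^ D2 * rename Sum.inl (p2 * t1) +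
      H2 * X (Sum.inr 0) ^ D1 * rename Sum.inl (p1 * t2), D1 + D2,
      d1 * d2 * aeval c t1 * aeval c t2, by simp [h1, h2, n1, n2], ?_⟩
    intro R _ _ _ _ w hw
    have q1 := congrArg (algebraMap K1 R) k1
    have q2 := congrArg (algebraMap K1 R) k2
    simp only [map_add, map_mul, map_pow, aeval_X, Sum.elim_inr, aeval_rename, Sum.elim_comp_inl,
      e1 R w hw, e2 R w hw, aeval_algebraMap_apply] at q1 q2 ⊢
    rw [q1, q2]
    ring
  | mul_X f i hf =>
    obtain ⟨H1, D1, d1, h1, e1⟩ := hf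
    refine ⟨H1 * X (Sum.inr i.succ), D1 + 1, d1, h1, ?_⟩
    intro R _ _ _ _ w hw
    rw [map_mul, e1 R w hw, map_mul, aeval_X, aeval_X, Sum.elim_inr, pow_succ]
    field_simp

lemma mpc_theta {K Ω R J : Type*} [Field K] [Field Ω] [Field R] [Algebra K Ω] [Algebra K R]
    (x : J → Ω) (hx : AlgebraicIndependent K x) (hx' : IntermediateField.adjoin K (Set.range x) = ⊤)
    (y : J → R) (hy : AlgebraicIndependent K y) :
    ∃ Θ : Ω →ₐ[K] R, ∀ j, Θ (x j) = y j := by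
  let e1 := hx.aevalEquivField
  let e2 : Ω →ₐ[K] IntermediateField.adjoin K (Set.range x) :=
    ((IntermediateField.equivOfEq hx').trans IntermediateField.topEquiv).symm.toAlgHom
  let θ : FractionRing (MvPolynomial J K) →ₐ[K] R :=
    IsFractionRing.liftAlgHom (K := FractionRing (MvPolynomial J K))
    (algebraicIndependent_iff_injective_aeval.1 hy)
  refine ⟨(θ.comp e1.symm.toAlgHom).comp e2, fun j => ?_⟩
  have h1 : e2 (x j) = e1 (algebraMap (MvPolynomial J K) (FractionRing (MvPolynomial J K)) (X j)) := by
    apply Subtype.ext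
    rw [hx.aevalEquivField_algebraMap_apply_coe, aeval_X]
    rfl
  have h2 : θ (algebraMap (MvPolynomial J K) _ (X j)) = y j := by
    have h3 := IsFractionRing.lift_algebraMap (K := FractionRing (MvPolynomial J K))
      (g := (aeval y : MvPolynomial J K →ₐ[K] R).toRingHom)
      (algebraicIndependent_iff_injective_aeval.1 hy) (X j)
    refine h3.trans ?_
    exact aeval_X y j
  simp only [AlgHom.comp_apply, h1]
  rw [← h2]
  congr 1
  exact e1.symm_apply_apply _

/-- Dehomogenized evaluation. -/
def mpcCons {R : Type*} [CommRing R] {r : ℕ} (x : Fin r → R) : Fin (r + 1) → R := 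
  fun i => Fin.cases (motive := fun _ => R) 1 (fun i' => x i') i

lemma mpc_dehom {K1 R : Type*} [Field K1] [CommRing R] [Algebra K1 R] {r : ℕ} (x : Fin r → R)
    (G : MvPolynomial (Fin (r + 1)) K1) :
    aeval x (aeval (fun i : Fin (r + 1) =>
            Fin.cases (motive := fun _ => MvPolynomial (Fin r) K1) 1
              (fun i' => MvPolynomial.X i') i) G) = eval (mpcCons x) (map (algebraMap K1 R) G) := by
  rw [eval_map, ← aeval_def, ← AlgHom.comp_apply, comp_aeval]
  congr 2
  ext i
  refine Fin.cases ?_ (fun i => ?_) i <;> simp [mpcCons]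

lemma mpc_eval_aeval {K1 E : Type*} [Field K1] [Field E] [Algebra K1 E] {σ τ : Type*}
    (U : σ → MvPolynomial τ E) (x : τ → E) (p : MvPolynomial σ K1) :
    eval x (aeval U p) = eval (fun i => eval x (U i)) (map (algebraMap K1 E) p) := by
  induction p using MvPolynomial.induction_on with
  | C a => simp [MvPolynomial.algebraMap_apply]
  | add a b ha hb => rw [map_add, map_add, ha, hb, map_add, map_add]
  | mul_X a i ha => rw [map_mul, map_mul, ha, map_mul, map_mul, aeval_X, map_X, eval_X]

lemma mpc_exists_s {K1 : Type u} [Field K1] {r m q : ℕ} 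
    (hcard : m < Fintype.card {i : Fin (r + 1) // q < (i : ℕ)})
    (G : Fin m → MvPolynomial (Fin (r + 1)) K1)
    (hGs : ∀ j, ∀ μ ∈ (G j).support, ∃ i : Fin (r + 1), q < (i : ℕ) ∧ μ i ≠ 0) :
    ∃ s : Fin r, q < (s.succ : ℕ) ∧ X s ∉ Ideal.span (Set.range fun j => MvPolynomial.aeval
          (fun i : Fin (r + 1) =>
            Fin.cases (motive := fun _ => MvPolynomial (Fin r) K1) 1
              (fun i' => MvPolynomial.X i') i) (G j)) := by
  classical
  let E := AlgebraicClosure K1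
  let σ := Fintype.equivFin {i : Fin (r + 1) // q < (i : ℕ)}
  let n := Fintype.card {i : Fin (r + 1) // q < (i : ℕ)}
  let U : Fin (r + 1) → MvPolynomial (Fin n) E := mpcCons fun i =>
    if h : q < (i.succ : ℕ) then X (σ ⟨i.succ, h⟩) else 0
  obtain ⟨x, hx0, hx⟩ := mpc_exists_zero (k := E) n (by rw [Fintype.card_fin]; exact hcard)
    (fun j : Fin m => aeval U (G j)) (by
      intro j
      rw [mpc_eval_aeval, eval_eq']
      refine Finset.sum_eq_zero fun μ hμ => ?_
      obtain ⟨i, hi, hi2⟩ := hGs j μ (support_map_subset _ _ hμ)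
      rw [Finset.prod_eq_zero (Finset.mem_univ i), mul_zero]
      have : eval 0 (U i) = 0 := by
        revert hi
        refine Fin.cases ?_ (fun i => ?_) i
        · intro h; simp at h
        · intro h; simp only [U, mpcCons, Fin.cases_succ]; rw [dif_pos h]; simp
      rw [this, zero_pow hi2])
  obtain ⟨a, ha⟩ := Function.ne_iff.mp hx0
  obtain ⟨⟨s, hs⟩, rfl⟩ := σ.surjective a
  have hsne : s ≠ 0 := by rintro rfl; simp at hs
  obtain ⟨s', rfl⟩ := Fin.exists_succ_eq_of_ne_zero hsne
  refine ⟨s', hs, fun hmem => ?_⟩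
  let w : Fin r → E := fun i => if h : q < (i.succ : ℕ) then x (σ ⟨i.succ, h⟩) else 0
  have hle : Ideal.span (Set.range fun j => MvPolynomial.aeval
          (fun i : Fin (r + 1) =>
            Fin.cases (motive := fun _ => MvPolynomial (Fin r) K1) 1
              (fun i' => MvPolynomial.X i') i) (G j)) ≤ RingHom.ker (aeval w : MvPolynomial (Fin r) K1 →ₐ[K1] E) := by
    rw [Ideal.span_le]
    rintro _ ⟨j, rfl⟩
    simp only [SetLike.mem_coe, RingHom.mem_ker]
    rw [mpc_dehom, ← hx j]
    rw [mpc_eval_aeval]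
    congr 2
    ext i
    refine Fin.cases ?_ (fun i => ?_) i
    · simp [U, mpcCons]
    · simp only [U, mpcCons, w, Fin.cases_succ]
      split_ifs <;> simp
  have := hle hmem
  rw [RingHom.mem_ker] at this
  simp only [aeval_X, w] at this
  rw [dif_pos hs] at this
  exact ha this

end assembly

section assembly2


lemma mpc_P {K K1 : Type u} [Field K] [Field K1] [Algebra K K1] {r m : ℕ} (Y : Fin (r + 1) → Prop)
    {s : Fin (r + 1)} {lev : Fin (r + 1) → ℕ} (c : MpcB Y m → K1)
    (hc : IntermediateField.adjoin K (Set.range c) = ⊤) (f : MvPolynomial (Fin r) K1) :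
    ∃ (P : MvPolynomial (MpcJ s lev m) K) (D : ℕ) (d0 : K1), d0 ≠ 0 ∧
      ∀ (R : Type u) [Field R] [Algebra K R] [Algebra K1 R] [IsScalarTower K K1 R]
        (φ : MvPolynomial (MpcJ s lev m) K →ₐ[K] R) (z : MpcJ s lev m → R)
        (_ : z = φ ∘ X)
        (_ : ∀ p : MpcB Y m, coeff p.2.1 (mpcG z p.1) = algebraMap K1 R (c p))
        (_ : mpcXi z 0 ≠ 0),
        φ P = algebraMap K1 R d0 * (mpcXi z 0) ^ D *
          aeval (fun i : Fin r => mpcXi z i.succ / mpcXi z 0) f := by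
  obtain ⟨H, D, d0, hd0, h⟩ := mpc_clear c hc f
  refine ⟨aeval (Sum.elim (fun p : MpcB Y m => coeff p.2.1 (mpcG (X : MpcJ s lev m → MvPolynomial (MpcJ s lev m) K) p.1))
    (mpcXi X)) H, D, d0, hd0, ?_⟩
  intro R _ _ _ _ φ z hz hcoef h0
  rw [← h R (mpcXi z) h0, ← AlgHom.comp_apply, comp_aeval]
  congr 2
  ext x
  rcases x with p | i
  · simp only [Sum.elim_inl, Function.comp]
    rw [← hcoef p, hz]
    have := mpcG_map (X : MpcJ s lev m → MvPolynomial (MpcJ s lev m) K) (φ : _ →+* R) p.1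
    have h2 := congrArg (coeff p.2.1) this
    rw [coeff_map] at h2
    exact h2
  · simp only [Sum.elim_inr]
    rw [hz]
    exact mpcXi_map (X : MpcJ s lev m → MvPolynomial (MpcJ s lev m) K) (φ : _ →+* R) i

lemma mpc_coeff_eq {K1 R : Type*} [Field K1] [Field R] [Algebra K1 R] {r m : ℕ}
    (Y : Fin (r + 1) → Prop) {s : Fin (r + 1)} {lev : Fin (r + 1) → ℕ}
    (hY : ∀ i, Y i ↔ lev i = 0) (hs : lev s = 0)
    (G : Fin m → MvPolynomial (Fin (r + 1)) K1) (hG : ∀ j, (G j).IsHomogeneous ((j : ℕ) + 1))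
    (hGs : ∀ j, ∀ μ ∈ (G j).support, ∃ i, Y i ∧ μ i ≠ 0)
    (z : MpcJ s lev m → R)
    (h : ∀ p : MpcB Y m, coeff p.2.1 (mpcG z p.1) = algebraMap K1 R (coeff p.2.1 (G p.1))) (j : Fin m) :
    mpcG z j = map (algebraMap K1 R) (G j) := by
  ext μ
  rw [coeff_map]
  by_cases h1 : ∑ i, μ i = (j : ℕ) + 1
  · by_cases h2 : ∃ i, Y i ∧ μ i ≠ 0
    · exact h ⟨j, μ, h1, h2⟩
    · have e1 : coeff μ (G j) = 0 := by
        by_contra hne; exact h2 (hGs j μ (mem_support_iff.mpr hne))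
      rw [e1, map_zero]
      apply mpcG_supp z hs
      intro i hi
      by_contra hne
      exact h2 ⟨i, (hY i).mpr hi, hne⟩
  · have e1 : coeff μ (G j) = 0 := by
      by_contra hne; exact h1 (mpc_homog_sum (hG j) hne)
    have e2 : coeff μ (mpcG z j) = 0 := by
      by_contra hne; exact h1 (mpc_homog_sum (mpcG_homog z j) hne)
    rw [e1, e2, map_zero]

lemma mpc_field_aux {F : Type*} [Field F] (a b c : F) (ha : a ≠ 0) (hb : b ≠ 0) :
    a * (b⁻¹ * c) / (a * (b⁻¹ * 1)) = c := by
  field_simp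

theorem mpc_main {K K1 : Type u} [Field K] [Field K1] [Algebra K K1] {r m q : ℕ}
    (lev : Fin (r + 1) → ℕ) (hY : ∀ i : Fin (r + 1), q < (i : ℕ) ↔ lev i = 0)
    (hE : ∀ s, lev s = 0 → ∃ e : MpcE s lev m → Fin (r + 1), Function.Injective e ∧
      (∀ ε, e ε ≠ s) ∧ ∀ ε, lev (e ε) + 1 = ε.1.2 s)
    (hT : Fintype.card {i : Fin (r + 1) // 2 ≤ lev i} +
      m * (m + 1) ^ (Fintype.card {i : Fin (r + 1) // 2 ≤ lev i}) < Fintype.card (MpcLt lev))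
    (hcard : m < Fintype.card {i : Fin (r + 1) // q < (i : ℕ)})
    (G : Fin m → MvPolynomial (Fin (r + 1)) K1)
    (hG : ∀ j, (G j).IsHomogeneous ((j : ℕ) + 1))
    (hGs : ∀ j, ∀ μ ∈ (G j).support, ∃ i : Fin (r + 1), q < (i : ℕ) ∧ μ i ≠ 0)
    (hai : AlgebraicIndependent K (fun p : MpcB (fun i : Fin (r + 1) => q < (i : ℕ)) m =>
      (G p.1).coeff p.2.1))
    (hadj : IntermediateField.adjoin K (⋃ j, Set.range (G j).coeff) = ⊤)
    (I : Ideal (MvPolynomial (Fin r) K1))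
    (hI : I = Ideal.span (Set.range fun j => MvPolynomial.aeval
          (fun i : Fin (r + 1) =>
            Fin.cases (motive := fun _ => MvPolynomial (Fin r) K1) 1
              (fun i' => MvPolynomial.X i') i) (G j)))
    (hprime : I.IsPrime) :
    ∃ (N : ℕ) (ψ : FractionRing ((MvPolynomial (Fin r) K1) ⧸ I) →ₐ[K1]
            FractionRing (MvPolynomial (Fin N) K1)),
        Function.Injective ψ := by
  classical
  obtain ⟨s', hs'q, hs'I⟩ := mpc_exists_s hcard G hGs
  rw [← hI] at hs'I
  set s : Fin (r + 1) := s'.succ with hsdef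
  have hs : lev s = 0 := (hY s).mp hs'q
  obtain ⟨e, he, hes, hel⟩ := hE s hs
  set Y : Fin (r + 1) → Prop := fun i => q < (i : ℕ) with hYdef
  set c : MpcB Y m → K1 := fun p => (G p.1).coeff p.2.1 with hcdef
  have hc : IntermediateField.adjoin K (Set.range c) = ⊤ := by
    rw [← top_le_iff, ← hadj, IntermediateField.adjoin_le_iff]
    intro x hx
    obtain ⟨j, μ, rfl⟩ := Set.mem_iUnion.mp hx
    by_cases h0 : coeff μ (G j) = 0
    · have h00 : (fun m => coeff m (G j)) μ = 0 := h0
      rw [h00]; exact zero_mem _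
    · exact IntermediateField.subset_adjoin _ _
        ⟨⟨j, μ, mpc_homog_sum (hG j) h0, hGs j μ (mem_support_iff.mpr h0)⟩, rfl⟩
  obtain ⟨hb1, hb2⟩ := mpcx_basis (K := K) (m := m) Y hY hs e he hes hel
  -- the rational function field
  have hfin : Finite (MpcT e) := inferInstance
  obtain ⟨N, ⟨τ⟩⟩ := Finite.exists_equiv_fin (MpcT e)
  let R := FractionRing (MvPolynomial (Fin N) K1)
  have hy1 : AlgebraicIndependent K1 (fun t : MpcT e => algebraMap (MvPolynomial (Fin N) K1) R (X (τ t))) := by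
    have h1 : AlgebraicIndependent K1 (fun t : MpcT e => (X (τ t) : MvPolynomial (Fin N) K1)) :=
      (algebraicIndependent_X (Fin N) K1).comp τ τ.injective
    exact h1.map' (f := IsScalarTower.toAlgHom K1 (MvPolynomial (Fin N) K1) R)
      (IsFractionRing.injective _ _)
  have hy2 := AlgebraicIndependent.sumElim_comp hai hy1
  obtain ⟨Θ, hΘ⟩ := mpc_theta _ hb2 hb1 _ hy2
  let S0 := MvPolynomial (MpcJ s lev m) K
  let φ : S0 →ₐ[K] R := Θ.comp (IsScalarTower.toAlgHom K S0 (FractionRing S0))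
  have hφinj : Function.Injective φ :=
    Θ.toRingHom.injective.comp (IsFractionRing.injective S0 (FractionRing S0))
  let z : MpcJ s lev m → R := φ ∘ X
  have hz : ∀ p : MpcB Y m, coeff p.2.1 (mpcG z p.1) = algebraMap K1 R (c p) := by
    intro p
    have h1 := hΘ (Sum.inr p)
    simp only [mpcx, Sum.elim_inr, Function.comp] at h1
    rw [← h1]
    have h2 := congrArg (coeff p.2.1) (mpcG_map (algebraMap S0 (FractionRing S0) ∘ X) Θ.toRingHom p.1)
    rw [coeff_map] at h2
    exact h2.symm
  have hzG := mpc_coeff_eq (R := R) Y hY hs G hG hGs z hz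
  -- the generic point
  let Q := MvPolynomial (Fin r) K1 ⧸ I
  let E := AlgebraicClosure (FractionRing Q)
  let x : Fin r → E := fun i => algebraMap Q E (Ideal.Quotient.mk I (X i))
  have hQE : Function.Injective (algebraMap Q E) := by
    rw [IsScalarTower.algebraMap_eq Q (FractionRing Q) E]
    exact (algebraMap (FractionRing Q) E).injective.comp (IsFractionRing.injective _ _)
  have hx : ∀ f : MvPolynomial (Fin r) K1, aeval x f = algebraMap Q E (Ideal.Quotient.mk I f) := by
    intro f
    induction f using MvPolynomial.induction_on with
    | C a => 
      rw [aeval_C]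
      rw [IsScalarTower.algebraMap_apply K1 Q E]
      rfl
    | add a b ha hb => rw [map_add, ha, hb, map_add, map_add]
    | mul_X a i ha => rw [map_mul, ha, map_mul, map_mul, aeval_X]
  have hx0 : ∀ f : MvPolynomial (Fin r) K1, aeval x f = 0 → f ∈ I := by
    intro f hf
    rw [hx, ← map_zero (algebraMap Q E)] at hf
    exact Ideal.Quotient.eq_zero_iff_mem.mp (hQE hf)
  have hxs : x s' ≠ 0 := by
    intro h
    exact hs'I (hx0 _ (by rw [aeval_X]; exact h))
  let ξ : Fin (r + 1) → E := fun i => (x s')⁻¹ * mpcCons x i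
  obtain ⟨z', hz', l, hl, hxi⟩ := mpc_special (k := E) (lev := lev) (s := s) hs
    (fun j => map (algebraMap K1 E) (G j)) (fun j => (hG j).map _)
    (fun j μ hμ => by
      obtain ⟨i, hi, hi2⟩ := hGs j μ (support_map_subset _ _ hμ)
      exact ⟨i, (hY i).mp hi, hi2⟩) ξ (by simp [ξ, mpcCons, hsdef, hxs])
    (fun j => by
      simp only [ξ]
      rw [mpc_eval_smul ((hG j).map _), ← mpc_dehom, hx]
      have : (aeval
          (fun i : Fin (r + 1) =>
            Fin.cases (motive := fun _ => MvPolynomial (Fin r) K1) 1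
              (fun i' => MvPolynomial.X i') i) (G j)) ∈ I := by
        rw [hI]; exact Ideal.subset_span ⟨j, rfl⟩
      rw [Ideal.Quotient.eq_zero_iff_mem.mpr this, map_zero, mul_zero]) hT
  have hxi0 : mpcXi z' 0 ≠ 0 := by
    rw [hxi]; simp [ξ, mpcCons, hl, hxs]
  have hxiq : ∀ i : Fin r, mpcXi z' i.succ / mpcXi z' 0 = x i := by
    intro i
    rw [hxi, hxi]
    exact mpc_field_aux l (x s') (x i) hl hxs
  have hX0 : mpcXi (X : MpcJ s lev m → S0) 0 ≠ 0 := by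
    intro h
    have h1 := mpcXi_map (X : MpcJ s lev m → S0) (aeval z' : S0 →ₐ[K] E).toRingHom 0
    rw [h, map_zero] at h1
    apply hxi0
    have h2 : (aeval z' : S0 →ₐ[K] E).toRingHom ∘ (X : MpcJ s lev m → S0) = z' := by
      ext i; exact aeval_X _ _
    rw [h2] at h1
    exact h1.symm
  have hz0 : mpcXi z 0 ≠ 0 := by
    intro h
    apply hX0
    apply hφinj
    rw [map_zero, ← h]
    exact mpcXi_map (X : MpcJ s lev m → S0) φ.toRingHom 0
  let χ : MvPolynomial (Fin r) K1 →ₐ[K1] R := aeval (fun i : Fin r => mpcXi z i.succ / mpcXi z 0)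
  have hχ1 : ∀ a ∈ I, χ a = 0 := by
    intro a ha
    have hle : I ≤ RingHom.ker χ := by
      rw [hI, Ideal.span_le]
      rintro _ ⟨j, rfl⟩
      simp only [SetLike.mem_coe, RingHom.mem_ker, χ]
      rw [mpc_dehom, ← hzG]
      have h1 : mpcCons (fun i : Fin r => mpcXi z i.succ / mpcXi z 0) =
          fun i => (mpcXi z 0)⁻¹ * mpcXi z i := by
        ext i
        refine Fin.cases ?_ (fun i => ?_) i
        · exact (inv_mul_cancel₀ hz0).symm
        · simp [mpcCons, div_eq_inv_mul]
      rw [h1, mpc_eval_smul (mpcG_homog z j), mpcG_eval_xi, mul_zero]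
    exact hle ha
  have hχ2 : ∀ a, χ a = 0 → a ∈ I := by
    intro f hf
    obtain ⟨P, D, d0, hd0, hP⟩ := mpc_P (K := K) (s := s) (lev := lev) Y c hc f
    have h1 := hP R φ z rfl hz hz0
    have hf' : aeval (fun i : Fin r => mpcXi z i.succ / mpcXi z 0) f = 0 := hf
    rw [hf', mul_zero] at h1
    have hP0 : P = 0 := hφinj (by rw [h1, map_zero])
    have h2 := hP E (aeval z') z' (by ext i; simp) (fun p => by rw [hz', coeff_map]) hxi0
    rw [hP0, map_zero] at h2
    apply hx0
    have h3 : (fun i : Fin r => mpcXi z' i.succ / mpcXi z' 0) = x := funext hxiq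
    rw [h3] at h2
    have h4 : algebraMap K1 E d0 ≠ 0 := by
      rw [Ne, map_eq_zero]; exact hd0
    rcases mul_eq_zero.mp h2.symm with h5 | h5
    · exact absurd h5 (mul_ne_zero h4 (pow_ne_zero _ hxi0))
    · exact h5
  let χ' : Q →ₐ[K1] R := Ideal.Quotient.liftₐ I χ hχ1
  have hχ' : Function.Injective χ' := by
    rw [injective_iff_map_eq_zero]
    intro a ha
    obtain ⟨f, rfl⟩ := Ideal.Quotient.mk_surjective a
    exact Ideal.Quotient.eq_zero_iff_mem.mpr (hχ2 f ha)
  refine ⟨N, IsFractionRing.liftAlgHom (K := FractionRing Q) hχ', ?_⟩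
  exact RingHom.injective _

end assembly2

section combi

lemma mpc_E {ι : Type*} [Fintype ι] [DecidableEq ι] {s : ι} {lev : ι → ℕ} {m : ℕ}
    (h : ∀ i < m, m * (m + 1) ^ (Fintype.card {x : ι // i + 2 ≤ lev x}) ≤
      Fintype.card {x : ι // lev x = i ∧ x ≠ s}) :
    ∃ e : MpcE s lev m → ι, Function.Injective e ∧
      (∀ ε, e ε ≠ s) ∧ ∀ ε, lev (e ε) + 1 = ε.1.2 s := by
  classical
  have hle : ∀ (ε : MpcE s lev m) (x : ι), ε.1.2 x ≤ m := by
    intro ε x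
    have h1 := ε.2.1
    have h2 : ε.1.2 x ≤ ∑ i, ε.1.2 i := Finset.single_le_sum (f := fun i => ε.1.2 i) (fun _ _ => Nat.zero_le _) (Finset.mem_univ x)
    have h3 := ε.1.1.2
    omega
  have key : ∀ i : ℕ, Nonempty ({ε : MpcE s lev m // ε.1.2 s = i + 1} ↪ {x : ι // lev x = i ∧ x ≠ s}) := by
    intro i
    by_cases him : i < m
    · have := Fintype.ofFinite (MpcE s lev m)
      apply Function.Embedding.nonempty_of_card_le
      refine le_trans ?_ (h i him)
      have : m * (m + 1) ^ (Fintype.card {x : ι // i + 2 ≤ lev x}) =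
          Fintype.card (Fin m × ({x : ι // i + 2 ≤ lev x} → Fin (m + 1))) := by
        simp
      rw [this]
      refine Fintype.card_le_of_injective (fun ε => (ε.1.1.1, fun x => ⟨ε.1.1.2 x.1, by
        have := hle ε.1 x.1; omega⟩)) ?_
      rintro ⟨ε, hε⟩ ⟨ε', hε'⟩ heq
      simp only [Prod.mk.injEq] at heq
      apply Subtype.ext
      apply Subtype.ext
      refine Prod.ext heq.1 ?_
      ext x
      change ε.1.2 x = ε'.1.2 x
      by_cases hxs : x = s
      · subst hxs; rw [hε, hε']
      · by_cases hx : i + 2 ≤ lev x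
        · have := congrFun heq.2 ⟨x, hx⟩
          simpa using this
        · have e1 : ε.1.2 x = 0 := by
            by_contra hne
            have := ε.2.2.1 x hxs hne
            omega
          have e2 : ε'.1.2 x = 0 := by
            by_contra hne
            have := ε'.2.2.1 x hxs hne
            omega
          rw [e1, e2]
    · have : IsEmpty {ε : MpcE s lev m // ε.1.2 s = i + 1} := by
        constructor
        rintro ⟨ε, hε⟩
        have := hle ε s
        omega
      exact ⟨Function.Embedding.ofIsEmpty⟩
  let F := fun i => (key i).some
  have hpos : ∀ ε : MpcE s lev m, ε.1.2 s = (ε.1.2 s - 1) + 1 := by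
    intro ε
    have := ε.2.2.2
    omega
  let e : MpcE s lev m → ι := fun ε => (F (ε.1.2 s - 1) ⟨ε, hpos ε⟩).1
  have he : ∀ (ε : MpcE s lev m) (i : ℕ) (hi : ε.1.2 s = i + 1), e ε = (F i ⟨ε, hi⟩).1 := by
    intro ε i hi
    have : i = ε.1.2 s - 1 := by omega
    subst this
    rfl
  have hlev : ∀ ε, lev (e ε) + 1 = ε.1.2 s := by
    intro ε
    have h1 : lev (e ε) = ε.1.2 s - 1 := (F (ε.1.2 s - 1) ⟨ε, hpos ε⟩).2.1
    have := hpos ε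
    omega
  refine ⟨e, ?_, fun ε => (F (ε.1.2 s - 1) ⟨ε, hpos ε⟩).2.2, hlev⟩
  intro ε ε' heq
  have h1 := hlev ε
  have h2 := hlev ε'
  rw [heq, h2] at h1
  have h3 := he ε (ε'.1.2 s - 1) (by rw [← h1]; exact hpos ε')
  have h4 := he ε' (ε'.1.2 s - 1) (hpos ε')
  rw [heq, h4] at h3
  have h5 := (F _).injective (Subtype.ext h3)
  exact (congrArg Subtype.val h5).symm

lemma mpc_card_le {n a : ℕ} (P : Fin n → Prop) [DecidablePred P] (h : ∀ x, P x → (x : ℕ) < a) :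
    Fintype.card {x : Fin n // P x} ≤ a := by
  rw [← Fintype.card_fin a]
  refine Fintype.card_le_of_injective (fun x => ⟨x.1.1, by simpa using h x.1 x.2⟩) ?_
  intro x y hxy
  simp only [Fin.mk.injEq] at hxy
  exact Subtype.ext (Fin.ext hxy)

lemma mpc_le_card {n a b : ℕ} (hb : a + b ≤ n) (P : Fin n → Prop) [DecidablePred P]
    (h : ∀ x : Fin n, a ≤ (x : ℕ) → (x : ℕ) < a + b → P x) :
    b ≤ Fintype.card {x : Fin n // P x} := by
  conv_lhs => rw [← Fintype.card_fin b]
  refine Fintype.card_le_of_injective (fun x => ⟨⟨a + x.1, by have := x.2; omega⟩, h _ (by simp) (by simp)⟩) ?_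
  intro x y hxy
  simp only [Subtype.mk.injEq, Fin.mk.injEq] at hxy
  exact Fin.ext (by omega)

lemma mpc_le_card' {n a b : ℕ} (hb : a + b + 1 ≤ n) (s : Fin n) (P : Fin n → Prop) [DecidablePred P]
    (h : ∀ x : Fin n, a ≤ (x : ℕ) → x ≠ s → P x) :
    b ≤ Fintype.card {x : Fin n // P x} := by
  conv_lhs => rw [← Fintype.card_fin b]
  refine Fintype.card_le_of_injective (fun x => ⟨⟨if a + x.1 < s.1 then a + x.1 else a + x.1 + 1, by
      have := x.2; split_ifs <;> omega⟩, h _ (by simp; split_ifs <;> omega) (by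
        intro h; have := congrArg Fin.val h; simp at this; split_ifs at this <;> omega)⟩) ?_
  intro x y hxy
  simp only [Subtype.mk.injEq, Fin.mk.injEq] at hxy
  apply Fin.ext
  split_ifs at hxy <;> omega

/-- The sizes of the flag. -/
def mpcSz (m : ℕ) : ℕ → ℕ
  | 0 => 0
  | k + 1 => mpcSz m k + m * (m + 1) ^ mpcSz m k + 1

lemma mpcSz_strictMono (m : ℕ) : StrictMono (mpcSz m) := by
  apply strictMono_nat_of_lt_succ
  intro k
  simp only [mpcSz]
  omega

lemma mpcSz_ge (m k : ℕ) : k * (m + 1) ≤ mpcSz m k := by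
  induction k with
  | zero => simp
  | succ k ih =>
    simp only [mpcSz]
    have : m ≤ m * (m + 1) ^ mpcSz m k := Nat.le_mul_of_pos_right _ (by positivity)
    rw [add_mul]
    omega

/-- The level function. -/
def mpcLev (m x : ℕ) : ℕ := m - Nat.findGreatest (fun k => mpcSz m k ≤ x) m

lemma mpcLev_spec (m x : ℕ) : ∃ g ≤ m, mpcLev m x = m - g ∧ mpcSz m g ≤ x ∧
    ∀ k, g < k → k ≤ m → x < mpcSz m k := by
  refine ⟨Nat.findGreatest (fun k => mpcSz m k ≤ x) m, Nat.findGreatest_le m, rfl, ?_, ?_⟩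
  · exact Nat.findGreatest_spec (P := fun k => mpcSz m k ≤ x) (Nat.zero_le m) (by simp [mpcSz])
  · intro k h1 h2
    have := Nat.findGreatest_is_greatest (P := fun k => mpcSz m k ≤ x) h1 h2
    omega

lemma mpcLev_zero (m x : ℕ) : mpcLev m x = 0 ↔ mpcSz m m ≤ x := by
  obtain ⟨g, h1, h2, h3, h4⟩ := mpcLev_spec m x
  rw [h2]
  constructor
  · intro h
    have : g = m := by omega
    rwa [this] at h3
  · intro h
    by_contra hne
    have := h4 m (by omega) le_rfl
    omega

lemma mpcLev_eq (m x i : ℕ) (hi : i < m) (hx1 : mpcSz m (m - i) ≤ x)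
    (hx2 : 0 < i → x < mpcSz m (m - i + 1)) : mpcLev m x = i := by
  rcases Nat.eq_zero_or_pos i with rfl | hpos
  · exact (mpcLev_zero m x).mpr hx1
  obtain ⟨g, h1, h2, h3, h4⟩ := mpcLev_spec m x
  have h5 := (mpcSz_strictMono m).lt_iff_lt.mp (lt_of_le_of_lt h3 (hx2 hpos))
  have h6 : ¬ g < m - i := by
    intro h
    have := h4 (m - i) h (by omega)
    omega
  omega

lemma mpcLev_ge (m x i : ℕ) (h : i + 2 ≤ mpcLev m x) : x < mpcSz m (m - 1 - i) := by
  obtain ⟨g, h1, h2, h3, h4⟩ := mpcLev_spec m x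
  exact h4 _ (by omega) (by omega)

end combi

end helpers

/-- For `K` a field of characteristic zero and `d ≥ 3`, the constants of the
Morin–Predonzan–Ciliberto theorem for the multidegree `d̲ = (1, 2, …, 2d-2)` can be
chosen with `q(d̲) ≥ 2d - 2`: there exist `c` and `q` with `q ≥ 2d - 2` such that for
every `r ≥ c`, every complete intersection of multidegree `(1, 2, …, 2d-2)` in `ℙ^r`
which is generic over `K` subject to containing a linear space `L₀ ≅ ℙ^q` is unirational
over the field generated over `K` by its coefficients (see `MPCProperty` for the precise
function field formulation). -/
theorem stmt_2 (K : Type u) [Field K] [CharZero K] (d : ℕ) (hd : 3 ≤ d) :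
    ∃ c q : ℕ, 2 * d - 2 ≤ q ∧ q < c ∧
      MPCProperty K (2 * d - 2) (fun j => (j : ℕ) + 1) c q := by
  obtain ⟨m, hm⟩ : ∃ m, m = 2 * d - 2 := ⟨_, rfl⟩
  rw [← hm]
  have hm1 : 1 ≤ m := by omega
  set A := mpcSz m m with hA
  have hAm : m + 1 ≤ A := le_trans (Nat.le_mul_of_pos_left _ hm1) (mpcSz_ge m m)
  refine ⟨A + m * (m + 1) ^ A + m + 2, A - 1, by omega, by omega, ?_⟩
  intro r hr hqr K1 _ _ G hG hGs hai hadj hprime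
  have hmono := (mpcSz_strictMono m).monotone
  refine mpc_main (K := K) (q := A - 1) (fun i : Fin (r + 1) => mpcLev m i) ?_ ?_ ?_ ?_ G hG hGs hai hadj _ rfl
    hprime
  · intro i
    rw [mpcLev_zero]
    omega
  · intro s _
    apply mpc_E
    intro i hi
    have h1 : Fintype.card {x : Fin (r + 1) // i + 2 ≤ mpcLev m x} ≤ mpcSz m (m - 1 - i) :=
      mpc_card_le _ (fun x hx => mpcLev_ge m x i hx)
    have h2 : m * (m + 1) ^ Fintype.card {x : Fin (r + 1) // i + 2 ≤ mpcLev m x} ≤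
        m * (m + 1) ^ mpcSz m (m - i) :=
      Nat.mul_le_mul_left _ (Nat.pow_le_pow_right (by omega) (h1.trans (hmono (by omega))))
    refine h2.trans ?_
    rcases Nat.eq_zero_or_pos i with rfl | hpos
    · refine mpc_le_card' (a := A) (by rw [Nat.sub_zero, ← hA]; omega) s _ ?_
      intro x hx hxs
      exact ⟨(mpcLev_zero m x).mpr hx, hxs⟩
    · have h3 : mpcSz m (m - i + 1) = mpcSz m (m - i) + m * (m + 1) ^ mpcSz m (m - i) + 1 := rfl
      have h4 : mpcSz m (m - i + 1) ≤ A := hmono (by omega)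
      refine mpc_le_card (a := mpcSz m (m - i)) (by omega) _ ?_
      intro x hx1 hx2
      have h5 : mpcLev m x = i := mpcLev_eq m x i hi hx1 (fun _ => by omega)
      refine ⟨h5, ?_⟩
      rintro rfl
      omega
  · have h1 : Fintype.card {x : Fin (r + 1) // 2 ≤ mpcLev m x} ≤ mpcSz m (m - 1) :=
      mpc_card_le _ (fun x hx => by
        have := mpcLev_ge m x 0 (by simpa using hx)
        simpa using this)
    have h2 : m * (m + 1) ^ Fintype.card {x : Fin (r + 1) // 2 ≤ mpcLev m x} ≤
        m * (m + 1) ^ mpcSz m (m - 1) :=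
      Nat.mul_le_mul_left _ (Nat.pow_le_pow_right (by omega) h1)
    have h3 : A = mpcSz m (m - 1) + m * (m + 1) ^ mpcSz m (m - 1) + 1 := by
      have h0 : mpcSz m (m - 1 + 1) = mpcSz m (m - 1) + m * (m + 1) ^ mpcSz m (m - 1) + 1 := rfl
      rw [hA, ← h0]
      congr 1
      omega
    have h4 : A ≤ Fintype.card (MpcLt (fun i : Fin (r + 1) => mpcLev m i)) := by
      refine mpc_le_card (a := 0) (by omega) _ ?_
      intro x _ hx h0
      have := (mpcLev_zero m x).mp h0
      omega
    omega
  · refine lt_of_lt_of_le (Nat.lt_succ_self m) (mpc_le_card (a := A) (by omega) _ ?_)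
    intro x hx _
    omega
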